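/- Let F ∈ R^{l×m} (l ≤ m) be of full row rank with d_l(F) associated to d_1^{p} d_2^{q}, where d_1 = x_1 − f_1(x_2,...,x_n), d_2 = x_2 − f_2(x_3,...,x_n) for some f_1 ∈ K[x_2,...,x_n], f_2 ∈ K[x_3,...,x_n], and p, q are positive integers. Then F is equivalent to its Smith normal form B = [D 0_{l×(m−l)}], where D = diag(d_1^{r_1}d_2^{s_1},..., d_1^{r_l}d_2^{s_l}) with d_k(F) associated to d_1^{p_k}d_2^{q_k}, p_0 = q_0 = 0, r_k = p_k − p_{k−1}, s_k = q_k − q_{k−1}, if and only if J_k(F) = R for all k = 1,2,...,l. -/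

import Mathlib

open Matrix MvPolynomial

/-- The set of `k × k` minors of a matrix: determinants of submatrices obtained by
choosing `k` rows and `k` columns. -/
def minorsSet {R : Type*} [CommRing R] {l m : ℕ} (k : ℕ)
    (F : Matrix (Fin l) (Fin m) R) : Set R :=
  { d | ∃ (ri : Fin k → Fin l) (ci : Fin k → Fin m),
      Function.Injective ri ∧ Function.Injective ci ∧ d = (F.submatrix ri ci).det }

/-- `d` is a greatest common divisor of the `k × k` minors of `F`. -/
def IsGcdMinors {R : Type*} [CommRing R] {l m : ℕ} (k : ℕ)
    (F : Matrix (Fin l) (Fin m) R) (d : R) : Prop :=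
  (∀ a ∈ minorsSet k F, d ∣ a) ∧ ∀ e : R, (∀ a ∈ minorsSet k F, e ∣ a) → e ∣ d

/-- `J_k(F) = R` : the ideal generated by the reduced `k`-th order minors
(the `k × k` minors divided by their g.c.d.) is the unit ideal. -/
def JEqTop {R : Type*} [CommRing R] {l m : ℕ} (k : ℕ)
    (F : Matrix (Fin l) (Fin m) R) : Prop :=
  ∃ d : R, IsGcdMinors k F d ∧ Ideal.span { b : R | d * b ∈ minorsSet k F } = ⊤

/-- The normal rank of a polynomial matrix: its rank over the fraction field. -/
noncomputable def normalRank {K : Type*} [Field K] {n l m : ℕ}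
    (F : Matrix (Fin l) (Fin m) (MvPolynomial (Fin n) K)) : ℕ :=
  (F.map (algebraMap (MvPolynomial (Fin n) K)
      (FractionRing (MvPolynomial (Fin n) K)))).rank

/-- Equivalence of matrices: `G = M * F * N` with `M`, `N` unimodular
(i.e. with determinant a unit, a nonzero constant). -/
def MatEquiv {R : Type*} [CommRing R] {l m : ℕ}
    (F G : Matrix (Fin l) (Fin m) R) : Prop :=
  ∃ (M : Matrix (Fin l) (Fin l) R) (N : Matrix (Fin m) (Fin m) R),
    IsUnit M.det ∧ IsUnit N.det ∧ G = M * F * N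

/-- A matrix is zero left prime (ZLP) if its maximal (row-size) order minors
generate the unit ideal. -/
def ZLP {R : Type*} [CommRing R] {l m : ℕ} (F : Matrix (Fin l) (Fin m) R) : Prop :=
  Ideal.span (minorsSet l F) = ⊤

/-- A square matrix is split idempotent if it is similar to a block diagonal matrix with an
identity block and a zero block. -/
def IsSplitIdempotent {R : Type*} [CommRing R] {N : ℕ} (E : Matrix (Fin N) (Fin N) R) : Prop :=
  ∃ (r s : ℕ) (U : Matrix (Fin N) (Fin r ⊕ Fin s) R) (V : Matrix (Fin r ⊕ Fin s) (Fin N) R),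
    U * V = 1 ∧ V * U = 1 ∧ V * E * U = fromBlocks 1 0 0 0

theorem map_fromBlocks_one_zero {R S : Type*} [CommRing R] [CommRing S] (f : R →+* S) (r s : ℕ) :
    (fromBlocks 1 0 0 0 : Matrix (Fin r ⊕ Fin s) (Fin r ⊕ Fin s) R).map f =
      fromBlocks 1 0 0 0 := by
  rw [fromBlocks_map, Matrix.map_one _ f.map_zero f.map_one, Matrix.map_zero _ f.map_zero,
    Matrix.map_zero _ f.map_zero, Matrix.map_zero _ f.map_zero]

theorem IsSplitIdempotent.map {R S : Type*} [CommRing R] [CommRing S] {N : ℕ}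
    {E : Matrix (Fin N) (Fin N) R} (h : IsSplitIdempotent E) (f : R →+* S) :
    IsSplitIdempotent (E.map f) := by
  obtain ⟨r, s, U, V, h1, h2, h3⟩ := h
  refine ⟨r, s, U.map f, V.map f, ?_, ?_, ?_⟩
  · rw [← Matrix.map_mul, h1, Matrix.map_one _ f.map_zero f.map_one]
  · rw [← Matrix.map_mul, h2, Matrix.map_one _ f.map_zero f.map_one]
  · rw [← Matrix.map_mul, ← Matrix.map_mul, h3, map_fromBlocks_one_zero]

theorem IsSplitIdempotent.conj {R : Type*} [CommRing R] {N : ℕ}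
    {E E' G G' : Matrix (Fin N) (Fin N) R} (h : IsSplitIdempotent E)
    (h1 : G * G' = 1) (h2 : G' * G = 1) (h3 : G' * E' * G = E) : IsSplitIdempotent E' := by
  obtain ⟨r, s, U, V, h4, h5, h6⟩ := h
  refine ⟨r, s, G * U, V * G', ?_, ?_, ?_⟩
  · rw [Matrix.mul_assoc, ← Matrix.mul_assoc U, h4, Matrix.one_mul, h1]
  · rw [Matrix.mul_assoc, ← Matrix.mul_assoc G', h2, Matrix.one_mul, h5]
  · rw [← h6, ← h3]
    simp only [Matrix.mul_assoc]

/-- Idempotent matrices over a principal ideal domain are split. -/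
theorem isSplitIdempotent_of_isPrincipalIdealRing {R : Type*} [CommRing R] [IsDomain R]
    [IsPrincipalIdealRing R] {N : ℕ} {E : Matrix (Fin N) (Fin N) R} (hE : E * E = E) :
    IsSplitIdempotent E := by
  set f := Matrix.toLin' E with hf
  have hid : IsIdempotentElem f := by
    rw [IsIdempotentElem, hf, Module.End.mul_eq_comp, ← Matrix.toLin'_mul, hE]
  obtain ⟨r, b1⟩ := Submodule.basisOfPid (Pi.basisFun R (Fin N)) f.range
  obtain ⟨s, b2⟩ := Submodule.basisOfPid (Pi.basisFun R (Fin N)) f.ker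
  set b := (b1.prod b2).map (Submodule.prodEquivOfIsCompl _ _ (LinearMap.IsIdempotentElem.isCompl hid)) with hb
  have hl : ∀ i, f (b (Sum.inl i)) = b (Sum.inl i) := by
    intro i
    have hm : b (Sum.inl i) = (b1 i : Fin N → R) := by simp [hb]
    rw [hm]
    obtain ⟨y, hy⟩ := (b1 i).2
    rw [← hy]
    exact LinearMap.congr_fun hid y
  have hr : ∀ i, f (b (Sum.inr i)) = 0 := by
    intro i
    have hm : b (Sum.inr i) = (b2 i : Fin N → R) := by simp [hb]
    rw [hm]
    exact (b2 i).2
  refine ⟨r, s, (Pi.basisFun R (Fin N)).toMatrix b, b.toMatrix (Pi.basisFun R (Fin N)),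
    Module.Basis.toMatrix_mul_toMatrix_flip _ _, Module.Basis.toMatrix_mul_toMatrix_flip _ _, ?_⟩
  have hm : E = LinearMap.toMatrix (Pi.basisFun R (Fin N)) (Pi.basisFun R (Fin N)) f := by
    rw [hf, ← Matrix.toLin_eq_toLin', LinearMap.toMatrix_toLin]
  rw [hm, basis_toMatrix_mul_linearMap_toMatrix_mul_basis_toMatrix]
  ext i j
  rw [LinearMap.toMatrix_apply]
  rcases j with j | j
  · rw [hl]
    rcases i with i | i
    · simp [Matrix.one_apply, Finsupp.single_apply, eq_comm]
    · simp
  · rw [hr]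
    rcases i with i | i <;> simp

/-- A matrix intertwining two standard idempotents is block diagonal. -/
theorem eq_fromBlocks_of_intertwine {R : Type*} [CommRing R] {r s r' s' : ℕ}
    {T : Matrix (Fin r' ⊕ Fin s') (Fin r ⊕ Fin s) R}
    (h : (fromBlocks 1 0 0 0 : Matrix (Fin r' ⊕ Fin s') (Fin r' ⊕ Fin s') R) * T =
      T * (fromBlocks 1 0 0 0 : Matrix (Fin r ⊕ Fin s) (Fin r ⊕ Fin s) R)) :
    T = fromBlocks T.toBlocks₁₁ 0 0 T.toBlocks₂₂ := by
  rw [← fromBlocks_toBlocks T, fromBlocks_multiply, fromBlocks_multiply, fromBlocks_inj] at h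
  simp only [Matrix.one_mul, Matrix.zero_mul, Matrix.mul_zero, Matrix.mul_one, add_zero] at h
  conv_lhs => rw [← fromBlocks_toBlocks T, h.2.1, ← h.2.2.1]

/-- Invertible matrices over a field lift along a surjection that reflects units. -/
theorem exists_lift_invertible {L k ι : Type*} [CommRing L] [Field k] [Fintype ι] [DecidableEq ι]
    (f : L →+* k) (hs : Function.Surjective f)
    (hu : ∀ a : k, a ≠ 0 → ∃ b, IsUnit b ∧ f b = a)
    (D : Matrix ι ι k) (hD : D.det ≠ 0) :
    ∃ A : Matrix ι ι L, IsUnit A ∧ A.map f = D := by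
  refine Matrix.diagonal_transvection_induction_of_det_ne_zero
    (fun D => ∃ A : Matrix ι ι L, IsUnit A ∧ A.map f = D) D hD ?_ ?_ ?_
  · intro d hd
    rw [det_diagonal, Finset.prod_ne_zero_iff] at hd
    choose b hb hfb using fun i => hu (d i) (hd i (Finset.mem_univ i))
    refine ⟨diagonal b, ?_, ?_⟩
    · rw [isUnit_iff_isUnit_det, det_diagonal]
      exact IsUnit.prod_univ_iff.2 hb
    · rw [diagonal_map f.map_zero]
      congr 1
      ext i
      exact hfb i
  · intro t
    obtain ⟨c, hc⟩ := hs t.c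
    refine ⟨transvection t.i t.j c, ?_, ?_⟩
    · rw [isUnit_iff_isUnit_det, det_transvection_of_ne _ _ t.hij]
      exact isUnit_one
    · ext a b
      simp only [TransvectionStruct.toMatrix, transvection, map_apply, Matrix.add_apply,
        map_add, Matrix.one_apply, single_apply, apply_ite f, map_one, map_zero, hc]
  · rintro A B - - ⟨A', hA, rfl⟩ ⟨B', hB, rfl⟩
    exact ⟨A' * B', hA.mul hB, Matrix.map_mul⟩

/-- The multiplicative set of monic polynomials. -/
def monicSubmonoid (A : Type*) [CommRing A] : Submonoid (Polynomial A) where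
  carrier := {p | p.Monic}
  mul_mem' := Polynomial.Monic.mul
  one_mem' := Polynomial.monic_one

theorem monicSubmonoid_le_nonZeroDivisors (A : Type*) [CommRing A] :
    monicSubmonoid A ≤ nonZeroDivisors (Polynomial A) :=
  fun _ hp => Polynomial.Monic.mem_nonZeroDivisors hp

theorem natDegree_mul_le_add {A : Type*} [CommRing A] {p q : Polynomial A} {a b : ℕ}
    (hp : p.natDegree ≤ a) (hq : q.natDegree ≤ b) : (p * q).natDegree ≤ a + b :=
  Polynomial.natDegree_mul_le.trans (add_le_add hp hq)

/-- A form of Nakayama's lemma over a local ring for submodules with finitely generated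
cotype. -/
theorem eq_top_of_sup_fg_of_sup_smul {A E : Type*} [CommRing A] [IsLocalRing A] [AddCommGroup E]
    [Module A E] {M T : Submodule A E} (hT : T.FG) (h1 : ∀ x, ∃ t ∈ T, ∃ y ∈ M, x = t + y)
    (h2 : ∀ x, ∃ y ∈ M, x - y ∈ IsLocalRing.maximalIdeal A • (⊤ : Submodule A E)) : M = ⊤ := by
  have hTM : T ⊔ M = ⊤ := by
    refine eq_top_iff.2 fun x _ => ?_
    obtain ⟨t, ht, y, hy, rfl⟩ := h1 x
    exact Submodule.add_mem_sup ht hy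
  have hle : T ≤ M := by
    refine Submodule.le_of_le_smul_of_le_jacobson_bot (I := IsLocalRing.maximalIdeal A) hT
      (IsLocalRing.maximalIdeal_le_jacobson _) fun x _ => ?_
    obtain ⟨y, hy, hxy⟩ := h2 x
    rw [← hTM, Submodule.smul_sup] at hxy
    have : IsLocalRing.maximalIdeal A • T ⊔ IsLocalRing.maximalIdeal A • M ≤
        M ⊔ IsLocalRing.maximalIdeal A • T :=
      sup_le le_sup_right (le_trans Submodule.smul_le_right le_sup_left)
    have h3 := Submodule.add_mem _ (this hxy) (Submodule.mem_sup_left hy)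
    rwa [sub_add_cancel] at h3
  rwa [sup_eq_right.2 hle] at hTM

section Horrocks

set_option linter.unusedSectionVars false

variable {A : Type*} [CommRing A] {L : Type*} [CommRing L] [Algebra (Polynomial A) L]

theorem degreeLT_fg (d : ℕ) : (Polynomial.degreeLT A d).FG := by
  classical
  rw [Polynomial.degreeLT_eq_span_X_pow]
  exact ⟨_, rfl⟩

theorem exists_map_residue_eq [IsLocalRing A] {α β : Type*}
    (p : Matrix α β (Polynomial (IsLocalRing.ResidueField A))) :
    ∃ q : Matrix α β (Polynomial A), q.map (Polynomial.map (IsLocalRing.residue A)) = p := by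
  choose q hq using fun i j => Polynomial.map_surjective (IsLocalRing.residue A)
    IsLocalRing.residue_surjective (p i j)
  exact ⟨q, by ext1 i j; exact hq i j⟩

theorem mem_smul_top_of_map_residue_eq_zero [IsLocalRing A] {ι : Type*} [Finite ι]
    {p : ι → Polynomial A} (h : ∀ i, (p i).map (IsLocalRing.residue A) = 0) :
    p ∈ IsLocalRing.maximalIdeal A • (⊤ : Submodule A (ι → Polynomial A)) := by
  classical
  have := Fintype.ofFinite ι
  rw [← Finset.univ_sum_single p]
  refine Submodule.sum_mem _ fun i _ => ?_
  rw [(p i).as_sum_range, ← LinearMap.single_apply A (fun _ => Polynomial A), map_sum]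
  refine Submodule.sum_mem _ fun n _ => ?_
  rw [← mul_one ((p i).coeff n), ← smul_eq_mul, ← Polynomial.smul_monomial, map_smul]
  refine Submodule.smul_mem_smul ?_ trivial
  rw [← IsLocalRing.residue_eq_zero_iff, ← Polynomial.coeff_map, h i, Polynomial.coeff_zero]

section Localization

variable [IsLocalization (monicSubmonoid A) L]

theorem isUnit_algebraMap_of_monic {s : Polynomial A} (hs : s.Monic) :
    IsUnit (algebraMap _ L s) :=
  IsLocalization.map_units L (⟨s, hs⟩ : monicSubmonoid A)

theorem exists_monic_denominator {α : Type*} [Finite α] (f : α → L) :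
    ∃ s : Polynomial A, s.Monic ∧ ∃ g : α → Polynomial A,
      ∀ i, algebraMap _ L s * f i = algebraMap _ L (g i) := by
  obtain ⟨b, hb⟩ := IsLocalization.exist_integer_multiples_of_finite (monicSubmonoid A) f
  choose g hg using hb
  refine ⟨b, b.2, g, fun i => ?_⟩
  rw [hg i, Algebra.smul_def]

theorem algebraMap_polynomial_injective :
    Function.Injective (algebraMap (Polynomial A) L) :=
  IsLocalization.injective L (monicSubmonoid_le_nonZeroDivisors A)

end Localization

variable [Algebra A L] [IsScalarTower A (Polynomial A) L]

variable (A L) in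
/-- The fractions `g / s` with `s` monic and `deg g ≤ deg s`: the functions that are regular
at infinity. -/
def regularAtInfinity : Subalgebra A L where
  carrier := {a | ∃ g s : Polynomial A, s.Monic ∧ g.natDegree ≤ s.natDegree ∧
    a * algebraMap _ L s = algebraMap _ L g}
  mul_mem' := by
    rintro a b ⟨g, s, hs, hd, h⟩ ⟨g', s', hs', hd', h'⟩
    refine ⟨g * g', s * s', hs.mul hs', ?_, ?_⟩
    · rw [hs.natDegree_mul hs']
      exact natDegree_mul_le_add hd hd'
    · rw [map_mul, map_mul, ← h, ← h']
      ring
  add_mem' := by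
    rintro a b ⟨g, s, hs, hd, h⟩ ⟨g', s', hs', hd', h'⟩
    refine ⟨g * s' + s * g', s * s', hs.mul hs', ?_, ?_⟩
    · rw [hs.natDegree_mul hs']
      exact Polynomial.natDegree_add_le_of_degree_le (natDegree_mul_le_add hd le_rfl)
        (natDegree_mul_le_add le_rfl hd')
    · rw [map_mul, map_add, map_mul, map_mul, ← h, ← h']
      ring
  algebraMap_mem' := by
    intro c
    refine ⟨Polynomial.C c, 1, Polynomial.monic_one, by simp, ?_⟩
    rw [map_one, mul_one, IsScalarTower.algebraMap_apply A (Polynomial A) L,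
      Polynomial.algebraMap_eq]

variable [IsLocalization (monicSubmonoid A) L]

theorem exists_eq_algebraMap_add [Nontrivial A] (a : L) :
    ∃ b : Polynomial A, ∃ v ∈ regularAtInfinity A L, a = algebraMap _ L b + v := by
  obtain ⟨⟨g, s⟩, h⟩ := IsLocalization.surj (monicSubmonoid A) a
  have hs : (s : Polynomial A).Monic := s.2
  refine ⟨g /ₘ s, a - algebraMap _ L (g /ₘ s), ⟨g %ₘ s, s, hs, ?_, ?_⟩, by ring⟩
  · exact Polynomial.natDegree_le_natDegree (Polynomial.degree_modByMonic_lt g hs).le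
  · rw [sub_mul, h, ← map_mul, ← map_sub]
    congr 1
    linear_combination -Polynomial.modByMonic_add_div g (s : Polynomial A)

theorem exists_eq_C_of_mem_regularAtInfinity [Nontrivial A] {b : Polynomial A}
    (h : algebraMap _ L b ∈ regularAtInfinity A L) : ∃ c, b = Polynomial.C c := by
  obtain ⟨g, s, hs, hd, h⟩ := h
  rw [← map_mul] at h
  have h := algebraMap_polynomial_injective h
  by_cases hb : b = 0
  · exact ⟨0, by rw [hb, map_zero]⟩
  · refine ⟨_, Polynomial.eq_C_of_natDegree_eq_zero ?_⟩
    rw [← h, mul_comm, hs.natDegree_mul' hb] at hd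
    omega

variable [IsLocalRing A] {κ : Type*} [Field κ] [Algebra (Polynomial (IsLocalRing.ResidueField A)) κ]
  [IsFractionRing (Polynomial (IsLocalRing.ResidueField A)) κ] {ρ : L →+* κ}
  (hρ : ∀ p : Polynomial A, ρ (algebraMap (Polynomial A) L p) =
    algebraMap (Polynomial (IsLocalRing.ResidueField A)) κ (p.map (IsLocalRing.residue A)))

include hρ

theorem map_residue_eq_zero_of_mul {a : L} (ha : ρ a = 0) {p q : Polynomial A}
    (h : algebraMap _ L q * a = algebraMap _ L p) : p.map (IsLocalRing.residue A) = 0 := by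
  have h1 := congrArg ρ h
  rw [map_mul, ha, mul_zero, hρ] at h1
  exact (IsFractionRing.injective (Polynomial (IsLocalRing.ResidueField A)) κ)
    (by rw [← h1, map_zero])

theorem mem_smul_top_of_residue_eq_zero {ι : Type*} [Finite ι] {x : ι → L}
    (h : ∀ i, ρ (x i) = 0) :
    x ∈ IsLocalRing.maximalIdeal A • (⊤ : Submodule A (ι → L)) := by
  obtain ⟨s, hs, g, hg⟩ := exists_monic_denominator (A := A) x
  obtain ⟨c, hc⟩ := (isUnit_algebraMap_of_monic (L := L) hs).exists_left_inv
  have h1 := mem_smul_top_of_map_residue_eq_zero fun i =>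
    map_residue_eq_zero_of_mul hρ (h i) (hg i)
  let f : (ι → Polynomial A) →ₗ[A] (ι → L) :=
    LinearMap.compLeft (LinearMap.mulLeft A c ∘ₗ (IsScalarTower.toAlgHom A (Polynomial A) L)) ι
  have h2 := Submodule.mem_map_of_mem (f := f) h1
  have h3 : f g = x := by
    ext i
    change c * algebraMap _ L (g i) = x i
    rw [← hg, ← mul_assoc, hc, one_mul]
  rw [Submodule.map_smul'', h3] at h2
  exact Submodule.smul_mono le_rfl le_top h2

theorem residue_eq_zero_of_mem {a : A} (ha : a ∈ IsLocalRing.maximalIdeal A) (x : L) :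
    ρ (a • x) = 0 := by
  rw [Algebra.smul_def, IsScalarTower.algebraMap_apply A (Polynomial A) L, map_mul, hρ,
    Polynomial.algebraMap_eq, Polynomial.map_C, (IsLocalRing.residue_eq_zero_iff a).2 ha,
    map_zero, map_zero, zero_mul]

theorem exists_isUnit_of_polynomial_ne_zero {p : Polynomial (IsLocalRing.ResidueField A)}
    (hp : p ≠ 0) : ∃ b : L, IsUnit b ∧ ρ b = algebraMap _ κ p := by
  obtain ⟨c, hc⟩ := IsLocalRing.residue_surjective p.leadingCoeff
  have hlc := Polynomial.leadingCoeff_ne_zero.2 hp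
  obtain ⟨q, hq, -, hqm⟩ := Polynomial.lifts_and_degree_eq_and_monic
    (f := IsLocalRing.residue A) (p := Polynomial.C p.leadingCoeff⁻¹ * p)
    (by obtain ⟨q, hq⟩ := Polynomial.map_surjective (IsLocalRing.residue A)
          IsLocalRing.residue_surjective (Polynomial.C p.leadingCoeff⁻¹ * p)
        exact (Polynomial.mem_lifts _).2 ⟨q, hq⟩)
    (by rw [mul_comm]; exact Polynomial.monic_mul_leadingCoeff_inv hp)
  refine ⟨algebraMap _ L (Polynomial.C c * q), ?_, ?_⟩
  · rw [map_mul]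
    refine IsUnit.mul (IsUnit.map _ (IsUnit.map _ ?_)) (isUnit_algebraMap_of_monic hqm)
    rw [← IsLocalRing.residue_ne_zero_iff_isUnit, hc]
    exact hlc
  · rw [hρ, Polynomial.map_mul, hq, Polynomial.map_C, hc, ← mul_assoc, ← map_mul,
      mul_inv_cancel₀ hlc, map_one, one_mul]

theorem exists_isUnit_lift (a : κ) (ha : a ≠ 0) : ∃ b : L, IsUnit b ∧ ρ b = a := by
  obtain ⟨p, q, hq, rfl⟩ := IsFractionRing.div_surjective
    (A := Polynomial (IsLocalRing.ResidueField A)) a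
  have hp : p ≠ 0 := by
    rintro rfl
    simp at ha
  obtain ⟨b, hb, hb'⟩ := exists_isUnit_of_polynomial_ne_zero hρ hp
  obtain ⟨c, ⟨c, rfl⟩, hc'⟩ := exists_isUnit_of_polynomial_ne_zero hρ (nonZeroDivisors.ne_zero hq)
  refine ⟨b * ↑c⁻¹, hb.mul c⁻¹.isUnit, ?_⟩
  rw [← hb', ← hc', map_mul, div_eq_mul_inv, map_units_inv]

theorem residue_surjective : Function.Surjective ρ := by
  intro a
  by_cases ha : a = 0
  · exact ⟨0, by rw [ha, map_zero]⟩
  · obtain ⟨b, -, hb⟩ := exists_isUnit_lift hρ a ha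
    exact ⟨b, hb⟩

theorem exists_inv_mem_regularAtInfinity {u : L} (hu : u ∈ regularAtInfinity A L)
    (h1 : ρ u = 1) : ∃ w ∈ regularAtInfinity A L, u * w = 1 := by
  obtain ⟨g, s, hs, hd, h⟩ := hu
  have h2 : g.map (IsLocalRing.residue A) = s.map (IsLocalRing.residue A) := by
    refine IsFractionRing.injective (Polynomial (IsLocalRing.ResidueField A)) κ ?_
    rw [← hρ, ← hρ, ← h, map_mul, h1, one_mul]
  have h3 : IsLocalRing.residue A (g.coeff s.natDegree) = 1 := by
    rw [← Polynomial.coeff_map, h2, Polynomial.coeff_map, hs.coeff_natDegree, map_one]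
  obtain ⟨c, hc⟩ : IsUnit (g.coeff s.natDegree) := by
    rw [← IsLocalRing.residue_ne_zero_iff_isUnit, h3]
    exact one_ne_zero
  have hcg : (Polynomial.C (↑c⁻¹ : A) * g).natDegree ≤ s.natDegree :=
    (Polynomial.natDegree_C_mul_le _ _).trans hd
  have hcs : (Polynomial.C (↑c⁻¹ : A) * g).coeff s.natDegree = 1 := by
    rw [Polynomial.coeff_C_mul, ← hc, Units.inv_mul]
  have hm : (Polynomial.C (↑c⁻¹ : A) * g).Monic :=
    Polynomial.monic_of_natDegree_le_of_coeff_eq_one _ hcg hcs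
  have hdeg : s.natDegree ≤ (Polynomial.C (↑c⁻¹ : A) * g).natDegree :=
    Polynomial.le_natDegree_of_ne_zero (by rw [hcs]; exact one_ne_zero)
  obtain ⟨t, ht⟩ := (isUnit_algebraMap_of_monic (L := L) hm).exists_left_inv
  refine ⟨algebraMap _ L (Polynomial.C (↑c⁻¹ : A) * s) * t,
    ⟨Polynomial.C (↑c⁻¹ : A) * s, _, hm, ?_, ?_⟩, ?_⟩
  · exact (Polynomial.natDegree_C_mul_le _ _).trans hdeg
  · rw [mul_assoc, ht, mul_one]
  · rw [map_mul] at ht ⊢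
    rw [← h] at ht
    linear_combination ht

end Horrocks

section Horrocks

set_option linter.unusedSectionVars false

variable {A : Type*} [CommRing A] {L : Type*} [CommRing L] [Algebra (Polynomial A) L]

variable [Algebra A L] [IsScalarTower A (Polynomial A) L]

variable [IsLocalization (monicSubmonoid A) L]
variable [IsLocalRing A] {κ : Type*} [Field κ] [Algebra (Polynomial (IsLocalRing.ResidueField A)) κ]
  [IsFractionRing (Polynomial (IsLocalRing.ResidueField A)) κ] {ρ : L →+* κ}
  (hρ : ∀ p : Polynomial A, ρ (algebraMap (Polynomial A) L p) =
    algebraMap (Polynomial (IsLocalRing.ResidueField A)) κ (p.map (IsLocalRing.residue A)))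

omit [IsLocalRing A] in
theorem polynomial_pi_degreeLT_fg {ι : Type*} [Finite ι] (d : ℕ) :
    (Submodule.pi Set.univ (fun _ : ι => Polynomial.degreeLT A d)).FG :=
  Submodule.fg_pi fun _ => degreeLT_fg d

/-- The `A`-linear map given by multiplication by a matrix over `L`. -/
noncomputable def polynomialMulVec {α β : Type*} [Fintype β] (G : Matrix α β L) :
    (β → Polynomial A) →ₗ[A] (α → L) :=
  (G.mulVecLin.restrictScalars A) ∘ₗ
    LinearMap.compLeft (IsScalarTower.toAlgHom A (Polynomial A) L).toLinearMap β

theorem polynomialMulVec_apply {α β : Type*} [Fintype β] (G : Matrix α β L)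
    (b : β → Polynomial A) :
    polynomialMulVec G b = G *ᵥ (fun i => algebraMap (Polynomial A) L (b i)) := rfl

theorem algebraMap_mulVec {α β : Type*} [Fintype β] (P : Matrix α β (Polynomial A))
    (b : β → Polynomial A) (i : α) : algebraMap (Polynomial A) L ((P *ᵥ b) i) =
      (P.map (algebraMap (Polynomial A) L) *ᵥ fun j => algebraMap (Polynomial A) L (b j)) i :=
  RingHom.map_mulVec _ _ _ _

theorem exists_monic_denominator_matrix {α β : Type*} [Finite α] [Finite β] (P : Matrix α β L) :
    ∃ s : Polynomial A, s.Monic ∧ ∃ P' : Matrix α β (Polynomial A),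
      P'.map (algebraMap (Polynomial A) L) = algebraMap (Polynomial A) L s • P := by
  obtain ⟨s, hs, g, hg⟩ := exists_monic_denominator (A := A) (fun x : α × β => P x.1 x.2)
  refine ⟨s, hs, Matrix.of fun i j => g (i, j), ?_⟩
  ext i j
  exact (hg (i, j)).symm

theorem range_polynomialMulVec_sup_eq_top (hρ : ∀ p : Polynomial A,
    ρ (algebraMap (Polynomial A) L p) = algebraMap (Polynomial (IsLocalRing.ResidueField A)) κ
      (p.map (IsLocalRing.residue A)))
    {α β : Type*} [Fintype α] [Fintype β] [DecidableEq α] [DecidableEq β]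
    {G : Matrix α β L} {G' : Matrix β α L} (h1 : G * G' = 1)
    {V₀ : Matrix α β (Polynomial (IsLocalRing.ResidueField A))}
    {U₀ : Matrix β α (Polynomial (IsLocalRing.ResidueField A))} (h3 : V₀ * U₀ = 1)
    (hG : G.map ρ = V₀.map (algebraMap _ κ)) :
    LinearMap.range (polynomialMulVec (A := A) G) ⊔
      Submodule.pi Set.univ (fun _ : α => Subalgebra.toSubmodule (regularAtInfinity A L)) = ⊤ := by
  obtain ⟨s, hs, P, hP⟩ := exists_monic_denominator_matrix (A := A) G'
  refine eq_top_of_sup_fg_of_sup_smul (T := (Submodule.pi Set.univ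
    (fun _ : α => Polynomial.degreeLT A s.natDegree)).map
    (LinearMap.compLeft (IsScalarTower.toAlgHom A (Polynomial A) L).toLinearMap α))
    (Submodule.FG.map _ (polynomial_pi_degreeLT_fg _)) ?_ ?_
  · intro x
    choose a v hv hx using fun i => exists_eq_algebraMap_add (A := A) (x i)
    refine ⟨_, Submodule.mem_map_of_mem (r := fun i => a i %ₘ s) ?_,
      polynomialMulVec G (P *ᵥ fun i => a i /ₘ s) + v,
      Submodule.add_mem_sup ⟨_, rfl⟩ fun i _ => hv i, ?_⟩
    · intro i _
      refine Polynomial.mem_degreeLT.2 ?_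
      rw [← Polynomial.degree_eq_natDegree hs.ne_zero]
      exact Polynomial.degree_modByMonic_lt _ hs
    · have : polynomialMulVec G (P *ᵥ fun i => a i /ₘ s) =
          fun i => algebraMap (Polynomial A) L (s * (a i /ₘ s)) := by
        rw [polynomialMulVec_apply]
        simp only [algebraMap_mulVec, hP]
        rw [Matrix.mulVec_mulVec, Matrix.mul_smul, h1, Matrix.smul_mulVec, Matrix.one_mulVec]
        ext i
        simp
      rw [this]
      ext i
      simp only [Pi.add_apply]
      rw [hx i, ← add_assoc]
      congr 1
      change _ = algebraMap (Polynomial A) L (a i %ₘ s) + _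
      rw [← map_add, Polynomial.modByMonic_add_div]
  · intro x
    choose a v hv hx using fun i => exists_eq_algebraMap_add (A := A) (x i)
    obtain ⟨b, hb⟩ := exists_map_residue_eq
      (Matrix.of fun (i : β) (_ : Unit) => (U₀ *ᵥ fun i => (a i).map (IsLocalRing.residue A)) i)
    refine ⟨polynomialMulVec G (fun i => b i ()) + v,
      Submodule.add_mem_sup ⟨_, rfl⟩ fun i _ => hv i, ?_⟩
    refine mem_smul_top_of_residue_eq_zero hρ fun i => ?_
    rw [Pi.sub_apply, Pi.add_apply, hx i, add_sub_add_right_eq_sub, map_sub, sub_eq_zero, hρ,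
      polynomialMulVec_apply, RingHom.map_mulVec]
    have hb' : ∀ i, (b i ()).map (IsLocalRing.residue A) =
        (U₀ *ᵥ fun i => (a i).map (IsLocalRing.residue A)) i := fun i => congrFun (congrFun hb i) ()
    rw [hG]
    simp only [Function.comp_def, hρ, hb']
    have := RingHom.map_mulVec (algebraMap (Polynomial (IsLocalRing.ResidueField A)) κ) V₀
      (U₀ *ᵥ fun i => (a i).map (IsLocalRing.residue A)) i
    rw [Matrix.mulVec_mulVec, h3, Matrix.one_mulVec] at this
    exact this

theorem exists_of_residue_eq_zero (hρ : ∀ p : Polynomial A,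
    ρ (algebraMap (Polynomial A) L p) = algebraMap (Polynomial (IsLocalRing.ResidueField A)) κ
      (p.map (IsLocalRing.residue A)))
    {α β : Type*} [Fintype α] [Fintype β] [DecidableEq α] [DecidableEq β]
    {G : Matrix α β L} {G' : Matrix β α L} (h1 : G * G' = 1)
    {V₀ : Matrix α β (Polynomial (IsLocalRing.ResidueField A))}
    {U₀ : Matrix β α (Polynomial (IsLocalRing.ResidueField A))} (h3 : V₀ * U₀ = 1)
    (hG : G.map ρ = V₀.map (algebraMap _ κ)) {x : α → L} (hx : ∀ i, ρ (x i) = 0) :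
    ∃ y : β → Polynomial A, (∀ i, (y i).map (IsLocalRing.residue A) = 0) ∧
      ∃ z : α → regularAtInfinity A L, (∀ i, ρ (z i) = 0) ∧
        x = polynomialMulVec G y + fun i => (z i : L) := by
  have hm := mem_smul_top_of_residue_eq_zero hρ hx
  rw [← range_polynomialMulVec_sup_eq_top hρ h1 h3 hG] at hm
  refine Submodule.smul_induction_on hm ?_ ?_
  · intro a ha w hw
    obtain ⟨_, ⟨y, rfl⟩, z, hz, rfl⟩ := Submodule.mem_sup.1 hw
    refine ⟨a • y, fun i => ?_, a • fun i => ⟨z i, hz i trivial⟩, fun i => ?_, ?_⟩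
    · rw [Pi.smul_apply, Polynomial.map_smul, (IsLocalRing.residue_eq_zero_iff a).2 ha, zero_smul]
    · exact residue_eq_zero_of_mem hρ ha (z i)
    · rw [smul_add, map_smul]
      rfl
  · rintro _ _ ⟨y, hy, z, hz, rfl⟩ ⟨y', hy', z', hz', rfl⟩
    refine ⟨y + y', fun i => ?_, z + z', fun i => ?_, ?_⟩
    · rw [Pi.add_apply, Polynomial.map_add, hy, hy', add_zero]
    · simp [hz, hz']
    · rw [map_add, add_add_add_comm]
      rfl

theorem birkhoff_factorization (hρ : ∀ p : Polynomial A,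
    ρ (algebraMap (Polynomial A) L p) = algebraMap (Polynomial (IsLocalRing.ResidueField A)) κ
      (p.map (IsLocalRing.residue A)))
    {α β : Type*} [Fintype α] [Fintype β] [DecidableEq α] [DecidableEq β]
    {G : Matrix α β L} {G' : Matrix β α L} (h1 : G * G' = 1) (h2 : G' * G = 1)
    {V₀ : Matrix α β (Polynomial (IsLocalRing.ResidueField A))}
    {U₀ : Matrix β α (Polynomial (IsLocalRing.ResidueField A))} (h3 : V₀ * U₀ = 1)
    (h4 : U₀ * V₀ = 1) (hG : G.map ρ = V₀.map (algebraMap _ κ)) :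
    ∃ (H : Matrix β α (Polynomial A)) (H' : Matrix α β (Polynomial A))
      (Q Q' : Matrix α α (regularAtInfinity A L)), H * H' = 1 ∧ H' * H = 1 ∧ Q * Q' = 1 ∧
        Q' * Q = 1 ∧ G * H.map (algebraMap (Polynomial A) L) =
          Q.map (regularAtInfinity A L).val := by
  have hinj := algebraMap_polynomial_injective (A := A) (L := L)
  obtain ⟨H₁, hH₁⟩ := exists_map_residue_eq U₀
  have hcol : ∀ i j, ρ ((G * H₁.map (algebraMap (Polynomial A) L) - 1 : Matrix α α L) i j) = 0 := by
    intro i j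
    have e : (G * H₁.map (algebraMap (Polynomial A) L) - 1 : Matrix α α L).map ρ = 0 := by
      rw [Matrix.map_sub _ (map_sub ρ), Matrix.map_mul, Matrix.map_map, hG,
        Matrix.map_one _ ρ.map_zero ρ.map_one, sub_eq_zero]
      have : (⇑ρ ∘ ⇑(algebraMap (Polynomial A) L)) =
        (algebraMap (Polynomial (IsLocalRing.ResidueField A)) κ) ∘
          Polynomial.map (IsLocalRing.residue A) := funext hρ
      rw [this, ← Matrix.map_map, hH₁, ← Matrix.map_mul, h3,
        Matrix.map_one _ (map_zero _) (map_one _)]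
    exact congrFun (congrFun e i) j
  choose y hy z hz hx using fun j => exists_of_residue_eq_zero hρ h1 h3 hG fun i => hcol i j
  set H : Matrix β α (Polynomial A) := H₁ - Matrix.of fun i j => y j i with hH
  set Q : Matrix α α (regularAtInfinity A L) := 1 + Matrix.of fun i j => z j i with hQ
  have hHres : H.map (Polynomial.map (IsLocalRing.residue A)) = U₀ := by
    rw [← hH₁, hH]
    ext1 i j
    simp [hy]
  have hGH : G * H.map (algebraMap (Polynomial A) L) = Q.map (regularAtInfinity A L).val := by
    ext i j
    have := congrFun (hx j) i
    rw [Matrix.sub_apply, Pi.add_apply, polynomialMulVec_apply] at this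
    rw [hH, hQ, Matrix.map_sub _ (map_sub _), Matrix.mul_sub, Matrix.sub_apply]
    have e1 : (Q.map (regularAtInfinity A L).val) i j = (1 : Matrix α α L) i j + z j i := by
      rw [hQ]
      by_cases hij : i = j <;> simp [hij, Matrix.one_apply]
    rw [← hQ, e1]
    have e2 : (G * (Matrix.of fun i j => y j i).map (algebraMap (Polynomial A) L)) i j =
      (G *ᵥ fun i => algebraMap (Polynomial A) L (y j i)) i := rfl
    rw [e2]
    linear_combination this
  have hQdet : IsUnit Q.det := by
    have hr : ρ (Q.det : L) = 1 := by
      have : ρ.comp (regularAtInfinity A L).val.toRingHom Q.det = 1 := by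
        rw [RingHom.map_det]
        convert Matrix.det_one (n := α) (R := κ)
        ext i j
        by_cases hij : i = j <;> simp [hQ, hij, hz, Matrix.one_apply]
      exact this
    obtain ⟨w, hw, hw'⟩ := exists_inv_mem_regularAtInfinity hρ Q.det.2 hr
    exact IsUnit.of_mul_eq_one ⟨w, hw⟩ (Subtype.ext hw')
  have hQ1 := Matrix.mul_nonsing_inv Q hQdet
  have hQ2 := Matrix.nonsing_inv_mul Q hQdet
  have hQ1' := congrArg (fun M => Matrix.map M (regularAtInfinity A L).val) hQ1
  have hQ2' := congrArg (fun M => Matrix.map M (regularAtInfinity A L).val) hQ2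
  simp only [Matrix.map_mul, Matrix.map_one _ (map_zero (regularAtInfinity A L).val)
    (map_one (regularAtInfinity A L).val)] at hQ1' hQ2'
  have hHG : H.map (algebraMap (Polynomial A) L) = G' * Q.map (regularAtInfinity A L).val := by
    rw [← hGH, ← Matrix.mul_assoc, h2, Matrix.one_mul]
  obtain ⟨s, hs, P, hP⟩ := exists_monic_denominator_matrix (A := A)
    (Q⁻¹.map (regularAtInfinity A L).val * G)
  have hHP : H * P = s • (1 : Matrix β β (Polynomial A)) := by
    apply Matrix.map_injective hinj
    beta_reduce
    rw [Matrix.map_mul, hP, hHG, Matrix.mul_smul, Matrix.mul_assoc, ← Matrix.mul_assoc (Q.map _),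
      hQ1', Matrix.one_mul, h2]
    ext i j
    by_cases hij : i = j <;> simp [hij]
  have hsurj : LinearMap.range (H.mulVecLin.restrictScalars A) = ⊤ := by
    refine eq_top_of_sup_fg_of_sup_smul (polynomial_pi_degreeLT_fg (A := A) (ι := β) s.natDegree)
      ?_ ?_
    · intro b
      refine ⟨fun i => b i %ₘ s, ?_, _, ⟨P *ᵥ fun i => b i /ₘ s, rfl⟩, ?_⟩
      · intro i _
        refine Polynomial.mem_degreeLT.2 ?_
        rw [← Polynomial.degree_eq_natDegree hs.ne_zero]
        exact Polynomial.degree_modByMonic_lt _ hs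
      · rw [LinearMap.restrictScalars_apply, Matrix.mulVecLin_apply, Matrix.mulVec_mulVec, hHP,
          Matrix.smul_mulVec, Matrix.one_mulVec]
        ext1 i
        exact (Polynomial.modByMonic_add_div _ _).symm
    · intro b
      obtain ⟨c, hc⟩ := exists_map_residue_eq
        (Matrix.of fun (i : α) (_ : Unit) => (V₀ *ᵥ fun i => (b i).map (IsLocalRing.residue A)) i)
      have hc' : ∀ i, (c i ()).map (IsLocalRing.residue A) =
        (V₀ *ᵥ fun i => (b i).map (IsLocalRing.residue A)) i := fun i => congrFun (congrFun hc i) ()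
      refine ⟨_, ⟨fun i => c i (), rfl⟩, mem_smul_top_of_map_residue_eq_zero fun i => ?_⟩
      rw [Pi.sub_apply, Polynomial.map_sub, sub_eq_zero, LinearMap.restrictScalars_apply,
        Matrix.mulVecLin_apply]
      have e := RingHom.map_mulVec (Polynomial.mapRingHom (IsLocalRing.residue A)) H
        (fun i => c i ()) i
      simp only [Polynomial.coe_mapRingHom, Function.comp_def] at e
      rw [e, hHres]
      simp only [hc']
      rw [Matrix.mulVec_mulVec, h4, Matrix.one_mulVec]
  choose h' hh' using fun j : β => LinearMap.range_eq_top.1 hsurj (Pi.single j 1)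
  have hHH' : H * (Matrix.of fun i j => h' j i) = 1 := by
    ext1 i j
    have := congrFun (hh' j) i
    rw [Matrix.one_apply]
    rw [Pi.single_apply] at this
    exact this
  refine ⟨H, Matrix.of fun i j => h' j i, Q, Q⁻¹, hHH', ?_, hQ1, hQ2, hGH⟩
  apply Matrix.map_injective hinj
  have e := congrArg (fun M => Matrix.map M (algebraMap (Polynomial A) L)) hHH'
  simp only [Matrix.map_mul, Matrix.map_one _ (map_zero (algebraMap (Polynomial A) L))
    (map_one (algebraMap (Polynomial A) L))] at e ⊢
  have e' : (Matrix.of fun i j => h' j i).map (algebraMap (Polynomial A) L) =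
      Q⁻¹.map (regularAtInfinity A L).val * G := by
    have := congrArg (fun M => Q⁻¹.map (regularAtInfinity A L).val * G * M) e
    simp only [hHG] at this
    rw [Matrix.mul_one, ← Matrix.mul_assoc, Matrix.mul_assoc _ G, ← Matrix.mul_assoc G, h1,
      Matrix.one_mul, hQ2', Matrix.one_mul] at this
    exact this
  rw [e', hHG, Matrix.mul_assoc, ← Matrix.mul_assoc G, h1, Matrix.one_mul, hQ2']

end Horrocks

section Horrocks

variable {A : Type*} [CommRing A] {L : Type*} [CommRing L] [Algebra (Polynomial A) L]
  [Algebra A L] [IsScalarTower A (Polynomial A) L] [IsLocalization (monicSubmonoid A) L]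
  [IsLocalRing A] {κ : Type*} [Field κ] [Algebra (Polynomial (IsLocalRing.ResidueField A)) κ]
  [IsFractionRing (Polynomial (IsLocalRing.ResidueField A)) κ] {ρ : L →+* κ}

theorem fromBlocks_invertible_of_intertwine {k : Type*} [Field k] {r s r' s' : ℕ}
    {T : Matrix (Fin r' ⊕ Fin s') (Fin r ⊕ Fin s) k}
    {T' : Matrix (Fin r ⊕ Fin s) (Fin r' ⊕ Fin s') k} (h1 : T * T' = 1) (h2 : T' * T = 1)
    (h : (fromBlocks 1 0 0 0 : Matrix (Fin r' ⊕ Fin s') (Fin r' ⊕ Fin s') k) * T =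
      T * (fromBlocks 1 0 0 0 : Matrix (Fin r ⊕ Fin s) (Fin r ⊕ Fin s) k)) :
    ∃ (T₁ : Matrix (Fin r') (Fin r) k) (T₁' : Matrix (Fin r) (Fin r') k)
      (T₂ : Matrix (Fin s') (Fin s) k) (T₂' : Matrix (Fin s) (Fin s') k),
      T = fromBlocks T₁ 0 0 T₂ ∧ T₁ * T₁' = 1 ∧ T₁' * T₁ = 1 ∧ T₂ * T₂' = 1 ∧ T₂' * T₂ = 1 := by
  have h' : (fromBlocks 1 0 0 0 : Matrix (Fin r ⊕ Fin s) (Fin r ⊕ Fin s) k) * T' =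
      T' * (fromBlocks 1 0 0 0 : Matrix (Fin r' ⊕ Fin s') (Fin r' ⊕ Fin s') k) := by
    have := congrArg (fun M => T' * M * T') h
    simp only [← Matrix.mul_assoc, h2, Matrix.one_mul] at this
    rw [Matrix.mul_assoc, h1, Matrix.mul_one] at this
    exact this.symm
  have e := eq_fromBlocks_of_intertwine h
  have e' := eq_fromBlocks_of_intertwine h'
  rw [e, e', fromBlocks_multiply, ← fromBlocks_one, fromBlocks_inj] at h1 h2
  simp only [Matrix.mul_zero, Matrix.zero_mul, add_zero, zero_add] at h1 h2
  exact ⟨_, _, _, _, e, h1.1, h2.1, h1.2.2.2, h2.2.2.2⟩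

/-- Horrocks' theorem for idempotent matrices. -/
theorem horrocks (hρ : ∀ p : Polynomial A,
    ρ (algebraMap (Polynomial A) L p) = algebraMap (Polynomial (IsLocalRing.ResidueField A)) κ
      (p.map (IsLocalRing.residue A)))
    {N : ℕ} {E : Matrix (Fin N) (Fin N) (Polynomial A)} (hE : E * E = E)
    (hL : IsSplitIdempotent (E.map (algebraMap (Polynomial A) L))) :
    ∃ G G' : Matrix (Fin N) (Fin N) (Polynomial A), G * G' = 1 ∧ G' * G = 1 ∧
      G' * E * G = (E.map (Polynomial.eval 0)).map Polynomial.C := by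
  obtain ⟨r, s, U, V, hUV, hVU, hVEU⟩ := hL
  have hEbar : E.map (Polynomial.mapRingHom (IsLocalRing.residue A)) *
      E.map (Polynomial.mapRingHom (IsLocalRing.residue A)) =
      E.map (Polynomial.mapRingHom (IsLocalRing.residue A)) := by
    rw [← Matrix.map_mul, hE]
  obtain ⟨r', s', U₀, V₀, hUV₀, hVU₀, hVEU₀⟩ := isSplitIdempotent_of_isPrincipalIdealRing hEbar
  set g := algebraMap (Polynomial (IsLocalRing.ResidueField A)) κ with hg
  have hEρ : (E.map (algebraMap (Polynomial A) L)).map ρ =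
      (E.map (Polynomial.mapRingHom (IsLocalRing.residue A))).map g := by
    ext i j
    exact hρ _
  have a1 : U.map ρ * V.map ρ = 1 := by
    rw [← Matrix.map_mul, hUV, Matrix.map_one _ ρ.map_zero ρ.map_one]
  have a2 : V.map ρ * U.map ρ = 1 := by
    rw [← Matrix.map_mul, hVU, Matrix.map_one _ ρ.map_zero ρ.map_one]
  have a3 : U₀.map g * V₀.map g = 1 := by
    rw [← Matrix.map_mul, hUV₀, Matrix.map_one _ g.map_zero g.map_one]
  have a4 : V₀.map g * U₀.map g = 1 := by
    rw [← Matrix.map_mul, hVU₀, Matrix.map_one _ g.map_zero g.map_one]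
  have a5 := congrArg (fun M => Matrix.map M ρ) hVEU
  have a6 := congrArg (fun M => Matrix.map M g) hVEU₀
  simp only [Matrix.map_mul, map_fromBlocks_one_zero, hEρ] at a5 a6
  have hTT' : (V₀.map g * U.map ρ) * (V.map ρ * U₀.map g) = 1 := by
    rw [Matrix.mul_assoc, ← Matrix.mul_assoc (U.map ρ), a1, Matrix.one_mul, a4]
  have hT'T : (V.map ρ * U₀.map g) * (V₀.map g * U.map ρ) = 1 := by
    rw [Matrix.mul_assoc, ← Matrix.mul_assoc (U₀.map g), a3, Matrix.one_mul, a2]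
  obtain ⟨T₁, T₁', T₂, T₂', hT, b1, b2, b3, b4⟩ := fromBlocks_invertible_of_intertwine hTT' hT'T (by
    rw [← a5, ← a6]
    simp only [← Matrix.mul_assoc]
    rw [Matrix.mul_assoc _ (U₀.map g), a3, Matrix.mul_one, Matrix.mul_assoc _ (U.map ρ) (V.map ρ), a1,
      Matrix.mul_one])
  obtain rfl : r' = r := by
    simpa using Matrix.square_of_invertible T₁ T₁' b1 b2
  obtain rfl : s' = s := by
    simpa using Matrix.square_of_invertible T₂ T₂' b3 b4
  obtain ⟨D₁, hD₁, hD₁'⟩ := exists_lift_invertible ρ (residue_surjective hρ)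
    (exists_isUnit_lift hρ) T₁ (IsUnit.ne_zero (isUnit_det_of_right_inverse b1))
  obtain ⟨D₂, hD₂, hD₂'⟩ := exists_lift_invertible ρ (residue_surjective hρ)
    (exists_isUnit_lift hρ) T₂ (IsUnit.ne_zero (isUnit_det_of_right_inverse b3))
  obtain ⟨D₁', c1, c1'⟩ := isUnit_iff_exists.1 hD₁
  obtain ⟨D₂', c2, c2'⟩ := isUnit_iff_exists.1 hD₂
  set D : Matrix (Fin r' ⊕ Fin s') (Fin r' ⊕ Fin s') L := fromBlocks D₁ 0 0 D₂ with hD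
  set D' : Matrix (Fin r' ⊕ Fin s') (Fin r' ⊕ Fin s') L := fromBlocks D₁' 0 0 D₂' with hD'
  have d1 : D * D' = 1 := by
    rw [hD, hD', fromBlocks_multiply]
    simp [c1, c2]
  have d2 : D' * D = 1 := by
    rw [hD, hD', fromBlocks_multiply]
    simp [c1', c2']
  have d3 : D * (fromBlocks 1 0 0 0 : Matrix (Fin r' ⊕ Fin s') (Fin r' ⊕ Fin s') L) * D' =
      fromBlocks 1 0 0 0 := by
    rw [hD, hD', fromBlocks_multiply, fromBlocks_multiply]
    simp [c1]
  have d4 : D.map ρ = V₀.map g * U.map ρ := by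
    rw [hT, hD, fromBlocks_map, hD₁', hD₂', Matrix.map_zero _ ρ.map_zero,
      Matrix.map_zero _ ρ.map_zero]
  obtain ⟨H, H', Q, Q', e1, e2, e3, e4, e5⟩ := birkhoff_factorization hρ
    (G := D * V) (G' := U * D')
    (by rw [Matrix.mul_assoc, ← Matrix.mul_assoc V, hVU, Matrix.one_mul, d1])
    (by rw [Matrix.mul_assoc, ← Matrix.mul_assoc D', d2, Matrix.one_mul, hUV]) hVU₀ hUV₀
    (by rw [Matrix.map_mul, d4, Matrix.mul_assoc, a1, Matrix.mul_one])
  set ι := algebraMap (Polynomial A) L with hι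
  set v := (regularAtInfinity A L).val.toRingHom with hv
  have e5' : D * V * H.map ι = Q.map v := e5
  have e1' : H.map ι * H'.map ι = 1 := by
    rw [← Matrix.map_mul, e1, Matrix.map_one _ ι.map_zero ι.map_one]
  have e4' : Q'.map v * Q.map v = 1 := by
    rw [← Matrix.map_mul, e4, Matrix.map_one _ v.map_zero v.map_one]
  have f1 : H.map ι = U * D' * Q.map v := by
    rw [← e5', ← Matrix.mul_assoc, ← Matrix.mul_assoc, Matrix.mul_assoc U, d2, Matrix.mul_one, hUV,
      Matrix.one_mul]
  have f2 : H'.map ι = Q'.map v * (D * V) := by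
    rw [← Matrix.mul_one (Q'.map v * (D * V)), ← e1', ← Matrix.mul_assoc, Matrix.mul_assoc (Q'.map v),
      e5', e4', Matrix.one_mul]
  have f3 : (H' * E * H).map ι =
      (Q' * (fromBlocks 1 0 0 0 : Matrix (Fin r' ⊕ Fin s') (Fin r' ⊕ Fin s') _) * Q).map v := by
    rw [Matrix.map_mul, Matrix.map_mul, Matrix.map_mul, Matrix.map_mul, f1, f2,
      map_fromBlocks_one_zero, ← d3, ← hVEU]
    simp only [Matrix.mul_assoc]
  choose c hc using fun i j => exists_eq_C_of_mem_regularAtInfinity (A := A) (L := L)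
    (b := (H' * E * H) i j) (by
      have := congrFun (congrFun f3 i) j
      rw [Matrix.map_apply, Matrix.map_apply] at this
      rw [← hι, this]
      exact Subtype.prop _)
  have hHEH : H' * E * H = (Matrix.of c).map Polynomial.C := by
    ext1 i j
    exact hc i j
  have hHEH0 := congrArg (fun M => Matrix.map M (Polynomial.evalRingHom (0 : A))) hHEH
  have e10 := congrArg (fun M => Matrix.map M (Polynomial.evalRingHom (0 : A))) e1
  have e20 := congrArg (fun M => Matrix.map M (Polynomial.evalRingHom (0 : A))) e2
  simp only [Matrix.map_mul, Matrix.map_map, Matrix.map_one _ (map_zero (Polynomial.evalRingHom (0 : A)))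
    (map_one (Polynomial.evalRingHom (0 : A)))] at hHEH0 e10 e20
  have hz : (Matrix.of c).map (⇑(Polynomial.evalRingHom (0 : A)) ∘ ⇑Polynomial.C) = Matrix.of c := by
    ext i j
    simp
  rw [hz] at hHEH0
  have e10C := congrArg (fun M => Matrix.map M (Polynomial.C : A →+* _)) e10
  have e20C := congrArg (fun M => Matrix.map M (Polynomial.C : A →+* _)) e20
  have h0C := congrArg (fun M => Matrix.map M (Polynomial.C : A →+* _)) hHEH0
  simp only [Matrix.map_mul, Matrix.map_one _ (map_zero (Polynomial.C : A →+* _))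
    (map_one (Polynomial.C : A →+* _))] at e10C e20C h0C
  rw [← hHEH] at h0C
  set Hz := (H.map (Polynomial.evalRingHom (0 : A))).map (Polynomial.C : A →+* _)
  set Hz' := (H'.map (Polynomial.evalRingHom (0 : A))).map (Polynomial.C : A →+* _)
  refine ⟨H * Hz', Hz * H', ?_, ?_, ?_⟩
  · rw [Matrix.mul_assoc, ← Matrix.mul_assoc Hz', e20C, Matrix.one_mul, e1]
  · rw [Matrix.mul_assoc, ← Matrix.mul_assoc H', e2, Matrix.one_mul, e10C]
  · calc Hz * H' * E * (H * Hz') = Hz * (H' * E * H) * Hz' := by simp only [Matrix.mul_assoc]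
      _ = (Hz * Hz') * (E.map (Polynomial.evalRingHom (0 : A))).map (Polynomial.C : A →+* _) *
          (Hz * Hz') := by
        rw [← h0C]
        simp only [Matrix.mul_assoc]
      _ = _ := by
        rw [e10C, Matrix.one_mul, Matrix.mul_one]
        rfl

end Horrocks

/-- Similarity of square matrices. -/
def MatSim {R : Type*} [CommRing R] {N : ℕ} (P Q : Matrix (Fin N) (Fin N) R) : Prop :=
  ∃ G G' : Matrix (Fin N) (Fin N) R, G * G' = 1 ∧ G' * G = 1 ∧ G' * P * G = Q

theorem MatSim.refl {R : Type*} [CommRing R] {N : ℕ} (P : Matrix (Fin N) (Fin N) R) :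
    MatSim P P :=
  ⟨1, 1, by simp, by simp, by simp⟩

theorem MatSim.trans {R : Type*} [CommRing R] {N : ℕ} {P Q T : Matrix (Fin N) (Fin N) R}
    (h1 : MatSim P Q) (h2 : MatSim Q T) : MatSim P T := by
  obtain ⟨G, G', a1, a2, rfl⟩ := h1
  obtain ⟨H, H', b1, b2, rfl⟩ := h2
  refine ⟨G * H, H' * G', ?_, ?_, by simp only [Matrix.mul_assoc]⟩
  · rw [Matrix.mul_assoc, ← Matrix.mul_assoc H, b1, Matrix.one_mul, a1]
  · rw [Matrix.mul_assoc, ← Matrix.mul_assoc G', a2, Matrix.one_mul, b2]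

theorem MatSim.map {R S : Type*} [CommRing R] [CommRing S] {N : ℕ}
    {P Q : Matrix (Fin N) (Fin N) R} (h : MatSim P Q) (f : R →+* S) :
    MatSim (P.map f) (Q.map f) := by
  obtain ⟨G, G', a1, a2, rfl⟩ := h
  refine ⟨G.map f, G'.map f, ?_, ?_, by simp only [Matrix.map_mul]⟩
  · rw [← Matrix.map_mul, a1, Matrix.map_one _ f.map_zero f.map_one]
  · rw [← Matrix.map_mul, a2, Matrix.map_one _ f.map_zero f.map_one]

section Patching

/-- The substitution `X ↦ X + Y`. -/
noncomputable def shiftHom (A : Type*) [CommRing A] :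
    Polynomial A →+* Polynomial (Polynomial A) :=
  Polynomial.eval₂RingHom (Polynomial.C.comp Polynomial.C)
    (Polynomial.C Polynomial.X + Polynomial.X)

/-- The substitution `Y ↦ c Y`. -/
noncomputable def dilateHom {A : Type*} [CommRing A] (c : A) :
    Polynomial (Polynomial A) →+* Polynomial (Polynomial A) :=
  Polynomial.eval₂RingHom Polynomial.C (Polynomial.C (Polynomial.C c) * Polynomial.X)

/-- The substitution `X ↦ x`. -/
noncomputable def substHom {A : Type*} [CommRing A] (x : Polynomial A) :
    Polynomial A →+* Polynomial A :=
  Polynomial.eval₂RingHom Polynomial.C x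

attribute [local instance] Polynomial.algebra in
theorem exists_denominator_polynomial_polynomial {A S : Type*} [CommRing A] [CommRing S]
    [Algebra A S] (M : Submonoid A) [IsLocalization M S] {ι : Type*} [Finite ι]
    (f : ι → Polynomial (Polynomial S)) :
    ∃ c ∈ M, ∃ g : ι → Polynomial (Polynomial A), ∀ i,
      Polynomial.mapRingHom (Polynomial.mapRingHom (algebraMap A S)) (g i) =
        Polynomial.C (Polynomial.C (algebraMap A S c)) * f i := by
  have h1 := Polynomial.isLocalization M S
  have h2 := Polynomial.isLocalization (M.map Polynomial.C) (Polynomial S)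
  obtain ⟨⟨_, _, ⟨c, hc, rfl⟩, rfl⟩, hb⟩ := IsLocalization.exist_integer_multiples_of_finite
    ((M.map (Polynomial.C : A →+* _)).map (Polynomial.C : Polynomial A →+* _)) f
  choose g hg using hb
  refine ⟨c, hc, g, fun i => ?_⟩
  have := hg i
  rw [Algebra.smul_def] at this
  have e : algebraMap (Polynomial (Polynomial A)) (Polynomial (Polynomial S)) =
    Polynomial.mapRingHom (Polynomial.mapRingHom (algebraMap A S)) := rfl
  rw [e] at this
  rw [this]
  simp

theorem exists_lift_dilate {A S : Type*} [CommRing A] [CommRing S] [Algebra A S]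
    (M : Submonoid A) [IsLocalization M S] {N : ℕ} {ι : Type*} [Finite ι]
    (W : ι → Matrix (Fin N) (Fin N) (Polynomial (Polynomial S)))
    (hW : ∀ i, (W i).map (Polynomial.evalRingHom 0) = 1) :
    ∃ c ∈ M, ∃ B : ι → Matrix (Fin N) (Fin N) (Polynomial (Polynomial A)), ∀ i,
      (B i).map (Polynomial.mapRingHom (Polynomial.mapRingHom (algebraMap A S))) =
        (W i).map (dilateHom (algebraMap A S c)) := by
  have h1 : ∀ i k l, ∃ t, W i k l = (1 : Matrix (Fin N) (Fin N) (Polynomial (Polynomial S))) k l +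
      Polynomial.X * t := by
    intro i k l
    obtain ⟨t, ht⟩ : Polynomial.X ∣ W i k l -
        (1 : Matrix (Fin N) (Fin N) (Polynomial (Polynomial S))) k l := by
      rw [Polynomial.X_dvd_iff, Polynomial.coeff_zero_eq_eval_zero]
      have e := congrFun (congrFun (hW i) k) l
      rw [Matrix.map_apply, Polynomial.coe_evalRingHom] at e
      rw [Polynomial.eval_sub, e]
      by_cases hkl : k = l <;> simp [hkl, Matrix.one_apply]
    exact ⟨t, by linear_combination ht⟩
  choose T hT using h1
  obtain ⟨c, hc, g, hg⟩ := exists_denominator_polynomial_polynomial M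
    (fun i : ι × Fin N × Fin N => T i.1 i.2.1 i.2.2)
  refine ⟨c, hc, fun i => 1 + (Polynomial.X : Polynomial (Polynomial A)) •
    (Matrix.of fun k l => dilateHom c (g (i, k, l)) :
      Matrix (Fin N) (Fin N) (Polynomial (Polynomial A))), fun i => ?_⟩
  have hnat : (Polynomial.mapRingHom (Polynomial.mapRingHom (algebraMap A S))).comp (dilateHom c) =
      (dilateHom (algebraMap A S c)).comp
        (Polynomial.mapRingHom (Polynomial.mapRingHom (algebraMap A S))) := by
    refine Polynomial.ringHom_ext (fun a => ?_) ?_ <;> simp [dilateHom]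
  beta_reduce
  ext1 k l
  have e1 := RingHom.congr_fun hnat (g (i, k, l))
  rw [RingHom.comp_apply, RingHom.comp_apply, hg, map_mul] at e1
  rw [Matrix.map_apply, Matrix.map_apply, hT, Matrix.add_apply, Matrix.smul_apply, map_add, map_add,
    smul_eq_mul, map_mul, map_mul, Matrix.of_apply, e1]
  have e2 : dilateHom (algebraMap A S c) (Polynomial.C (Polynomial.C (algebraMap A S c))) =
    Polynomial.C (Polynomial.C (algebraMap A S c)) := by simp [dilateHom]
  have e3 : dilateHom (algebraMap A S c) Polynomial.X =
    Polynomial.C (Polynomial.C (algebraMap A S c)) * Polynomial.X := by simp [dilateHom]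
  rw [e2, e3]
  by_cases hkl : k = l <;> simp [hkl, Matrix.one_apply] <;> ring

theorem exists_matSim_subst {A S : Type*} [CommRing A] [CommRing S] [Algebra A S]
    (M : Submonoid A) [IsLocalization M S] (hinj : Function.Injective (algebraMap A S)) {N : ℕ}
    {E : Matrix (Fin N) (Fin N) (Polynomial A)}
    (h : MatSim (E.map (Polynomial.mapRingHom (algebraMap A S)))
      ((E.map (Polynomial.mapRingHom (algebraMap A S))).map
        (Polynomial.C.comp (Polynomial.evalRingHom 0)))) :
    ∃ c ∈ M, ∀ x y : Polynomial A,
      MatSim (E.map (substHom (x + Polynomial.C c * y))) (E.map (substHom x)) := by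
  obtain ⟨G, G', h1, h2, h3⟩ := h
  set j := Polynomial.mapRingHom (algebraMap A S) with hj
  set jj := Polynomial.mapRingHom j with hjj
  have hjjinj : Function.Injective jj :=
    Polynomial.map_injective _ (Polynomial.map_injective _ hinj)
  let ev : Polynomial (Polynomial S) →+* Polynomial S := Polynomial.evalRingHom 0
  have ev1 : ev.comp (shiftHom S) = RingHom.id _ := by
    refine Polynomial.ringHom_ext (fun a => ?_) ?_ <;> simp [ev, shiftHom]
  have ev2 : ev.comp Polynomial.C = RingHom.id _ := by
    refine Polynomial.ringHom_ext (fun a => ?_) ?_ <;> simp [ev]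
  have evs : ∀ P : Matrix (Fin N) (Fin N) (Polynomial S), (P.map (shiftHom S)).map ev = P := by
    intro P
    rw [Matrix.map_map, ← RingHom.coe_comp, ev1, RingHom.coe_id, Matrix.map_id]
  have evC : ∀ P : Matrix (Fin N) (Fin N) (Polynomial S),
      (P.map (Polynomial.C : Polynomial S →+* _)).map ev = P := by
    intro P
    rw [Matrix.map_map, ← RingHom.coe_comp, ev2, RingHom.coe_id, Matrix.map_id]
  have mul_map_one : ∀ {T : Type _} [CommRing T] (f : Polynomial S →+* T)
      {P Q : Matrix (Fin N) (Fin N) (Polynomial S)}, P * Q = 1 → P.map f * Q.map f = 1 := by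
    intro T _ f P Q hPQ
    rw [← Matrix.map_mul, hPQ, Matrix.map_one _ f.map_zero f.map_one]
  set CC : Polynomial S →+* Polynomial (Polynomial S) := Polynomial.C with hCC
  obtain ⟨c, hc, B, hB⟩ := exists_lift_dilate M
    (fun b : Bool => bif b then G.map (shiftHom S) * G'.map CC
      else G.map CC * G'.map (shiftHom S)) (by
      rintro (_ | _)
      · change (G.map CC * G'.map (shiftHom S)).map ev = 1
        rw [Matrix.map_mul, evs, evC, h1]
      · change (G.map (shiftHom S) * G'.map CC).map ev = 1
        rw [Matrix.map_mul, evs, evC, h1])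
  have hBt : (B true).map jj =
      (G.map (shiftHom S) * G'.map CC).map (dilateHom (algebraMap A S c)) := hB true
  have hBf : (B false).map jj =
      (G.map CC * G'.map (shiftHom S)).map (dilateHom (algebraMap A S c)) := hB false
  have hs1 := mul_map_one (shiftHom S) h1
  have hs2 := mul_map_one (shiftHom S) h2
  have hC1 := mul_map_one CC h1
  have hC2 := mul_map_one CC h2
  have k1 : B true * B false = 1 := by
    apply Matrix.map_injective hjjinj
    beta_reduce
    rw [Matrix.map_mul, hBt, hBf, ← Matrix.map_mul, Matrix.mul_assoc, ← Matrix.mul_assoc (G'.map CC),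
      hC2, Matrix.one_mul, hs1, Matrix.map_one _ (map_zero _) (map_one _),
      Matrix.map_one _ (map_zero _) (map_one _)]
  have k2 : B false * B true = 1 := by
    apply Matrix.map_injective hjjinj
    beta_reduce
    rw [Matrix.map_mul, hBt, hBf, ← Matrix.map_mul, Matrix.mul_assoc,
      ← Matrix.mul_assoc (G'.map (shiftHom S)),
      hs2, Matrix.one_mul, hC1, Matrix.map_one _ (map_zero _) (map_one _),
      Matrix.map_one _ (map_zero _) (map_one _)]
  have hnat1 : jj.comp ((dilateHom c).comp (shiftHom A)) =
      ((dilateHom (algebraMap A S c)).comp (shiftHom S)).comp j := by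
    refine Polynomial.ringHom_ext (fun a => ?_) ?_ <;> simp [dilateHom, shiftHom, hjj, hj]
  have hnat2 : jj.comp Polynomial.C =
      ((dilateHom (algebraMap A S c)).comp CC).comp j := by
    refine Polynomial.ringHom_ext (fun a => ?_) ?_ <;> simp [dilateHom, hjj, hj, hCC]
  have k3 : B false * E.map ((dilateHom c).comp (shiftHom A)) * B true =
      E.map (Polynomial.C : Polynomial A →+* _) := by
    apply Matrix.map_injective hjjinj
    beta_reduce
    rw [Matrix.map_mul, Matrix.map_mul, hBt, hBf, Matrix.map_map, Matrix.map_map, ← RingHom.coe_comp,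
      ← RingHom.coe_comp, hnat1, hnat2, RingHom.coe_comp, RingHom.coe_comp, ← Matrix.map_map,
      ← Matrix.map_map, RingHom.coe_comp, RingHom.coe_comp, ← Matrix.map_map,
      ← Matrix.map_map, ← Matrix.map_mul, ← Matrix.map_mul]
    refine congrArg (fun P => Matrix.map P (dilateHom (algebraMap A S c))) ?_
    have h3s := congrArg (fun P => Matrix.map P (shiftHom S)) h3
    have h3C := congrArg (fun P => Matrix.map P CC) h3
    simp only [Matrix.map_mul, Matrix.map_map, ← RingHom.coe_comp] at h3s h3C
    have hconst : (shiftHom S).comp ((Polynomial.C.comp (Polynomial.evalRingHom 0)).comp j) =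
        CC.comp ((Polynomial.C.comp (Polynomial.evalRingHom 0)).comp j) := by
      refine Polynomial.ringHom_ext (fun a => ?_) ?_ <;> simp [shiftHom, hj, hCC]
    rw [hconst, ← h3C] at h3s
    calc _ = G.map CC * (G'.map (shiftHom S) * (E.map ⇑j).map (shiftHom S) * G.map (shiftHom S)) *
          G'.map CC := by simp only [Matrix.mul_assoc]
      _ = (G.map CC * G'.map CC) * (E.map ⇑j).map CC * (G.map CC * G'.map CC) := by
        rw [Matrix.map_map, ← RingHom.coe_comp, h3s, Matrix.map_map, ← RingHom.coe_comp]
        simp only [Matrix.mul_assoc]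
      _ = _ := by rw [hC1, Matrix.one_mul, Matrix.mul_one]
  refine ⟨c, hc, fun x y => ?_⟩
  have hsim : MatSim (E.map ((dilateHom c).comp (shiftHom A)))
    (E.map (Polynomial.C : Polynomial A →+* _)) := ⟨_, _, k1, k2, k3⟩
  have hsim' := hsim.map (Polynomial.eval₂RingHom (substHom x) y)
  rw [Matrix.map_map, Matrix.map_map, ← RingHom.coe_comp, ← RingHom.coe_comp] at hsim'
  convert hsim' using 3
  · refine Polynomial.ringHom_ext (fun a => ?_) ?_ <;>
      simp [dilateHom, shiftHom, substHom]
  · refine Polynomial.ringHom_ext (fun a => ?_) ?_ <;> simp [substHom]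

/-- Quillen's patching theorem for idempotent matrices over a domain. -/
theorem quillen_patching {A : Type*} [CommRing A] [IsDomain A] {N : ℕ}
    {E : Matrix (Fin N) (Fin N) (Polynomial A)}
    (h : ∀ (m : Ideal A) [m.IsMaximal],
      MatSim (E.map (Polynomial.mapRingHom (algebraMap A (Localization.AtPrime m))))
        ((E.map (Polynomial.mapRingHom (algebraMap A (Localization.AtPrime m)))).map
          (Polynomial.C.comp (Polynomial.evalRingHom 0)))) :
    MatSim E (E.map (Polynomial.C.comp (Polynomial.evalRingHom 0))) := by
  let I : Ideal A :=
    { carrier := {c | ∀ x y : Polynomial A,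
        MatSim (E.map (substHom (x + Polynomial.C c * y))) (E.map (substHom x))}
      zero_mem' := fun x y => by
        rw [map_zero, zero_mul, add_zero]
        exact MatSim.refl _
      add_mem' := fun {c d} hc hd x y => by
        rw [map_add, add_mul, ← add_assoc]
        exact (hd _ _).trans (hc _ _)
      smul_mem' := fun a c hc x y => by
        rw [smul_eq_mul, mul_comm a c, map_mul, mul_assoc]
        exact hc _ _ }
  have hI : I = ⊤ := by
    by_contra hne
    obtain ⟨m, hm, hle⟩ := Ideal.exists_le_maximal I hne
    obtain ⟨c, hc, hc'⟩ := exists_matSim_subst m.primeCompl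
      (IsLocalization.injective (Localization.AtPrime m) m.primeCompl_le_nonZeroDivisors) (h m)
    exact hc (hle hc')
  have h1 : (1 : A) ∈ I := hI ▸ Submodule.mem_top
  have h2 := h1 0 Polynomial.X
  convert h2 using 1
  · rw [map_one, one_mul, zero_add]
    have : substHom (Polynomial.X : Polynomial A) = RingHom.id _ := by
      refine Polynomial.ringHom_ext (fun a => ?_) ?_ <;> simp [substHom]
    rw [this, RingHom.coe_id, Matrix.map_id]
  · congr 2
    refine Polynomial.ringHom_ext (fun a => ?_) ?_ <;> simp [substHom]

end Patching

theorem IsSplitIdempotent.of_matSim {R : Type*} [CommRing R] {N : ℕ}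
    {P Q : Matrix (Fin N) (Fin N) R} (h : MatSim P Q) (hQ : IsSplitIdempotent Q) :
    IsSplitIdempotent P := by
  obtain ⟨G, G', h1, h2, h3⟩ := h
  exact hQ.conj h1 h2 h3

theorem IsSplitIdempotent.of_map_equiv {R S : Type*} [CommRing R] [CommRing S] {N : ℕ}
    (e : R ≃+* S) {E : Matrix (Fin N) (Fin N) R} (h : IsSplitIdempotent (E.map e)) :
    IsSplitIdempotent E := by
  have h' := h.map (e.symm : S →+* R)
  rw [Matrix.map_map] at h'
  convert h'
  ext i j
  simp

theorem isUnit_algebraMap_map_of_ne_zero {K A L : Type*} [Field K] [CommRing A] [CommRing L]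
    [Algebra (Polynomial A) L] [IsLocalization (monicSubmonoid A) L] (f : K →+* A)
    {p : Polynomial K} (hp : p ≠ 0) : IsUnit (algebraMap (Polynomial A) L (p.map f)) := by
  have hlc := Polynomial.leadingCoeff_ne_zero.2 hp
  have h1 : p = Polynomial.C p.leadingCoeff * (p * Polynomial.C p.leadingCoeff⁻¹) := by
    rw [mul_left_comm, ← map_mul, mul_inv_cancel₀ hlc, map_one, mul_one]
  rw [h1, Polynomial.map_mul, map_mul, Polynomial.map_C]
  refine IsUnit.mul (IsUnit.map _ (IsUnit.map _ (IsUnit.map f hlc.isUnit))) ?_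
  exact isUnit_algebraMap_of_monic ((Polynomial.monic_mul_leadingCoeff_inv hp).map f)

/-- After localizing at the monic polynomials in the last variable, an idempotent matrix comes
from a polynomial ring in fewer variables over a larger field. -/
theorem isSplitIdempotent_map_monic_localization {K : Type*} [Field K] {n : ℕ}
    {S : Type*} [CommRing S] (f : MvPolynomial (Fin n) K →+* S)
    {L : Type*} [CommRing L] [Algebra (Polynomial S) L] [IsLocalization (monicSubmonoid S) L]
    {N : ℕ} {E : Matrix (Fin N) (Fin N) (Polynomial (MvPolynomial (Fin n) K))} (hE : E * E = E)
    (ih : ∀ {E' : Matrix (Fin N) (Fin N)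
      (MvPolynomial (Fin n) (FractionRing (Polynomial K)))}, E' * E' = E' → IsSplitIdempotent E') :
    IsSplitIdempotent ((E.map (Polynomial.mapRingHom f)).map (algebraMap (Polynomial S) L)) := by
  let g : Polynomial K →+* L := (algebraMap (Polynomial S) L).comp
    (Polynomial.mapRingHom (f.comp MvPolynomial.C))
  have hg : ∀ y : nonZeroDivisors (Polynomial K), IsUnit (g y) := fun y =>
    isUnit_algebraMap_map_of_ne_zero _ (nonZeroDivisors.ne_zero y.2)
  let g' : FractionRing (Polynomial K) →+* L := IsLocalization.lift hg
  have hg' : ∀ p, g' (algebraMap _ _ p) = g p := fun p => IsLocalization.lift_eq hg p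
  let θ : MvPolynomial (Fin n) (FractionRing (Polynomial K)) →+* L :=
    MvPolynomial.eval₂Hom g' fun i => algebraMap (Polynomial S) L (Polynomial.C (f (X i)))
  let ψ : Polynomial (MvPolynomial (Fin n) K) →+*
      MvPolynomial (Fin n) (FractionRing (Polynomial K)) :=
    Polynomial.eval₂RingHom
      (MvPolynomial.map ((algebraMap (Polynomial K) (FractionRing (Polynomial K))).comp
        Polynomial.C))
      (MvPolynomial.C (algebraMap (Polynomial K) (FractionRing (Polynomial K)) Polynomial.X))
  have hθψ : θ.comp ψ = (algebraMap (Polynomial S) L).comp (Polynomial.mapRingHom f) := by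
    refine Polynomial.ringHom_ext' ?_ ?_
    · refine MvPolynomial.ringHom_ext (fun a => ?_) fun i => ?_
      · simp [θ, ψ, hg', g]
      · simp [θ, ψ]
    · simp [θ, ψ, hg', g]
  have h := (ih (E' := E.map ψ) (by rw [← Matrix.map_mul, hE])).map θ
  rwa [Matrix.map_map, ← RingHom.coe_comp, hθψ, RingHom.coe_comp, ← Matrix.map_map] at h

/-- The Quillen–Suslin theorem: idempotent matrices over a polynomial ring over a field are
split. -/
theorem quillen_suslin (n : ℕ) : ∀ (K : Type*) [Field K] {N : ℕ}
    {E : Matrix (Fin N) (Fin N) (MvPolynomial (Fin n) K)}, E * E = E → IsSplitIdempotent E := by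
  induction n with
  | zero =>
    intro K _ N E hE
    refine IsSplitIdempotent.of_map_equiv (isEmptyRingEquiv K (Fin 0)) ?_
    refine isSplitIdempotent_of_isPrincipalIdealRing ?_
    rw [← Matrix.map_mul, hE]
  | succ n ih =>
    intro K _ N E hE
    refine IsSplitIdempotent.of_map_equiv (finSuccEquiv K n).toRingEquiv ?_
    set E₁ := E.map (finSuccEquiv K n).toRingEquiv with hE₁
    have hE₁' : E₁ * E₁ = E₁ := by
      rw [hE₁, ← Matrix.map_mul, hE]
    have hpatch : MatSim E₁ (E₁.map (Polynomial.C.comp (Polynomial.evalRingHom 0))) := by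
      refine quillen_patching fun m _ => ?_
      set S := Localization.AtPrime m
      set L := Localization (monicSubmonoid S)
      set κ := FractionRing (Polynomial (IsLocalRing.ResidueField S))
      let r : Polynomial S →+* κ := (algebraMap _ κ).comp
        (Polynomial.mapRingHom (IsLocalRing.residue S))
      have hr : ∀ y : monicSubmonoid S, IsUnit (r y) := fun y => by
        have hy : (y : Polynomial S).Monic := y.2
        refine IsUnit.mk0 _ fun h0 => (hy.map (IsLocalRing.residue S)).ne_zero ?_
        exact (IsFractionRing.injective (Polynomial (IsLocalRing.ResidueField S)) κ)
          (h0.trans (map_zero _).symm)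
      refine horrocks (L := L) (ρ := IsLocalization.lift hr)
        (fun p => IsLocalization.lift_eq hr p) ?_ ?_
      · rw [← Matrix.map_mul, hE₁']
      · exact isSplitIdempotent_map_monic_localization _ hE₁' fun h => ih _ h
    refine IsSplitIdempotent.of_matSim hpatch ?_
    rw [RingHom.coe_comp, ← Matrix.map_map]
    refine (ih K ?_).map (Polynomial.C : MvPolynomial (Fin n) K →+* _)
    rw [← Matrix.map_mul, hE₁']

section MinorIdeal

variable {R : Type*} [CommRing R] {l m : ℕ}

/-- The ideal generated by the minors of order `k`. -/
def minorIdeal (k : ℕ) (F : Matrix (Fin l) (Fin m) R) : Ideal R :=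
  Ideal.span (minorsSet k F)

theorem det_submatrix_mem_minorIdeal {k : ℕ} (F : Matrix (Fin l) (Fin m) R)
    (ri : Fin k → Fin l) (ci : Fin k → Fin m) : (F.submatrix ri ci).det ∈ minorIdeal k F := by
  by_cases hr : Function.Injective ri
  · by_cases hc : Function.Injective ci
    · exact Ideal.subset_span ⟨ri, ci, hr, hc, rfl⟩
    · simp only [Function.Injective, not_forall] at hc
      obtain ⟨i, j, hij, hne⟩ := hc
      rw [Matrix.det_zero_of_column_eq hne fun a => by simp [hij]]
      exact Ideal.zero_mem _
  · simp only [Function.Injective, not_forall] at hr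
    obtain ⟨i, j, hij, hne⟩ := hr
    rw [Matrix.det_zero_of_row_eq hne (by ext a; simp [hij])]
    exact Ideal.zero_mem _

theorem minorIdeal_le_iff {k : ℕ} {F : Matrix (Fin l) (Fin m) R} {I : Ideal R} :
    minorIdeal k F ≤ I ↔ ∀ (ri : Fin k → Fin l) (ci : Fin k → Fin m), Function.Injective ri →
      Function.Injective ci → (F.submatrix ri ci).det ∈ I := by
  rw [minorIdeal, Ideal.span_le]
  constructor
  · exact fun h ri ci hr hc => h ⟨ri, ci, hr, hc, rfl⟩
  · rintro h _ ⟨ri, ci, hr, hc, rfl⟩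
    exact h ri ci hr hc

theorem minorIdeal_transpose_le (k : ℕ) (F : Matrix (Fin l) (Fin m) R) :
    minorIdeal k Fᵀ ≤ minorIdeal k F := by
  refine minorIdeal_le_iff.2 fun ri ci _ _ => ?_
  rw [← Matrix.det_transpose]
  exact det_submatrix_mem_minorIdeal F ci ri

theorem minorIdeal_transpose (k : ℕ) (F : Matrix (Fin l) (Fin m) R) :
    minorIdeal k Fᵀ = minorIdeal k F :=
  le_antisymm (minorIdeal_transpose_le k F) (minorIdeal_transpose_le k Fᵀ)

theorem minorIdeal_mul_left_le {l' : ℕ} (k : ℕ) (M : Matrix (Fin l') (Fin l) R)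
    (F : Matrix (Fin l) (Fin m) R) : minorIdeal k (M * F) ≤ minorIdeal k F := by
  refine minorIdeal_le_iff.2 fun ri ci _ _ => ?_
  have h : (M * F).submatrix ri ci =
      fun i => ∑ a, M (ri i) a • (F.submatrix id ci) a := by
    ext i j
    simp [Matrix.mul_apply]
  have h2 := (Matrix.detRowAlternating (R := R) (n := Fin k)).toMultilinearMap.map_sum
    (fun i a => M (ri i) a • (F.submatrix id ci) a)
  rw [h]
  refine (congrArg (· ∈ minorIdeal k F) h2).mpr ?_
  refine Ideal.sum_mem _ fun r _ => ?_
  rw [MultilinearMap.map_smul_univ]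
  exact Ideal.mul_mem_left _ _ (det_submatrix_mem_minorIdeal F r ci)

theorem minorIdeal_mul_right_le {m' : ℕ} (k : ℕ) (F : Matrix (Fin l) (Fin m) R)
    (N : Matrix (Fin m) (Fin m') R) : minorIdeal k (F * N) ≤ minorIdeal k F := by
  rw [← minorIdeal_transpose, ← minorIdeal_transpose k F, Matrix.transpose_mul]
  exact minorIdeal_mul_left_le k _ _

theorem minorIdeal_eq_of_matEquiv {F G : Matrix (Fin l) (Fin m) R} (h : MatEquiv F G) (k : ℕ) :
    minorIdeal k G = minorIdeal k F := by
  obtain ⟨M, N, hM, hN, rfl⟩ := h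
  refine le_antisymm ((minorIdeal_mul_right_le k _ _).trans (minorIdeal_mul_left_le k _ _)) ?_
  have hF : F = M⁻¹ * (M * F * N) * N⁻¹ := by
    simp only [Matrix.mul_assoc]
    rw [Matrix.mul_nonsing_inv N hN, Matrix.mul_one, ← Matrix.mul_assoc, Matrix.nonsing_inv_mul M hM,
      Matrix.one_mul]
  conv_lhs => rw [hF]
  exact (minorIdeal_mul_right_le k _ _).trans (minorIdeal_mul_left_le k _ _)

theorem minorIdeal_map {S : Type*} [CommRing S] (f : R →+* S) (k : ℕ)
    (F : Matrix (Fin l) (Fin m) R) : minorIdeal k (F.map f) = (minorIdeal k F).map f := by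
  rw [minorIdeal, minorIdeal, Ideal.map_span]
  congr 1
  ext a
  constructor
  · rintro ⟨ri, ci, hr, hc, rfl⟩
    exact ⟨_, ⟨ri, ci, hr, hc, rfl⟩, by rw [RingHom.map_det]; rfl⟩
  · rintro ⟨_, ⟨ri, ci, hr, hc, rfl⟩, rfl⟩
    exact ⟨ri, ci, hr, hc, by rw [RingHom.map_det]; rfl⟩

theorem minorIdeal_smul (k : ℕ) (c : R) (F : Matrix (Fin l) (Fin m) R) :
    minorIdeal k (c • F) = Ideal.span {c ^ k} * minorIdeal k F := by
  have hdet : ∀ (ri : Fin k → Fin l) (ci : Fin k → Fin m),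
      ((c • F).submatrix ri ci).det = c ^ k * (F.submatrix ri ci).det := by
    intro ri ci
    have := Matrix.det_smul (F.submatrix ri ci) c
    rw [Fintype.card_fin] at this
    exact this
  refine le_antisymm (minorIdeal_le_iff.2 fun ri ci _ _ => ?_) ?_
  · rw [hdet]
    exact Ideal.mul_mem_mul (Ideal.mem_span_singleton_self _) (det_submatrix_mem_minorIdeal F ri ci)
  · rw [minorIdeal, Ideal.span_mul_span', Ideal.span_le]
    rintro _ ⟨_, rfl, _, ⟨ri, ci, -, -, rfl⟩, rfl⟩
    change c ^ k * (F.submatrix ri ci).det ∈ _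
    rw [← hdet]
    exact det_submatrix_mem_minorIdeal _ _ _

theorem minorIdeal_succ_le (k : ℕ) (F : Matrix (Fin l) (Fin m) R) :
    minorIdeal (k + 1) F ≤ minorIdeal k F := by
  refine minorIdeal_le_iff.2 fun ri ci _ _ => ?_
  rw [Matrix.det_succ_row_zero]
  exact Ideal.sum_mem _ fun j _ => Ideal.mul_mem_left _ _ (det_submatrix_mem_minorIdeal F _ _)

theorem minorIdeal_zero (F : Matrix (Fin l) (Fin m) R) : minorIdeal 0 F = ⊤ := by
  rw [Ideal.eq_top_iff_one]
  simpa using det_submatrix_mem_minorIdeal F Fin.elim0 Fin.elim0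

theorem minorIdeal_eq_bot_of_lt {k : ℕ} (h : l < k) (F : Matrix (Fin l) (Fin m) R) :
    minorIdeal k F = ⊥ := by
  refine le_bot_iff.1 (minorIdeal_le_iff.2 fun ri ci hr _ => ?_)
  have := Fintype.card_le_of_injective ri hr
  simp only [Fintype.card_fin] at this
  omega

theorem apply_mem_minorIdeal_one (F : Matrix (Fin l) (Fin m) R) (i : Fin l) (j : Fin m) :
    F i j ∈ minorIdeal 1 F := by
  simpa using det_submatrix_mem_minorIdeal F (fun _ : Fin 1 => i) (fun _ => j)

/-- The block diagonal matrix with blocks `b` and `F`. -/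
def consMatrix (b : R) (F : Matrix (Fin l) (Fin m) R) : Matrix (Fin (l + 1)) (Fin (m + 1)) R :=
  Matrix.of (Fin.cons (Fin.cons b 0) fun i => Fin.cons 0 (F i))

@[simp] theorem consMatrix_zero_zero (b : R) (F : Matrix (Fin l) (Fin m) R) :
    consMatrix b F 0 0 = b := rfl

@[simp] theorem consMatrix_zero_succ (b : R) (F : Matrix (Fin l) (Fin m) R) (j : Fin m) :
    consMatrix b F 0 j.succ = 0 := rfl

@[simp] theorem consMatrix_succ_zero (b : R) (F : Matrix (Fin l) (Fin m) R) (i : Fin l) :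
    consMatrix b F i.succ 0 = 0 := rfl

@[simp] theorem consMatrix_succ_succ (b : R) (F : Matrix (Fin l) (Fin m) R) (i : Fin l)
    (j : Fin m) : consMatrix b F i.succ j.succ = F i j := rfl

theorem consMatrix_mul {k : ℕ} (a b : R) (F : Matrix (Fin l) (Fin m) R)
    (G : Matrix (Fin m) (Fin k) R) :
    consMatrix a F * consMatrix b G = consMatrix (a * b) (F * G) := by
  ext i j
  rw [Matrix.mul_apply, Fin.sum_univ_succ]
  refine Fin.cases ?_ (fun i => ?_) i <;> refine Fin.cases ?_ (fun j => ?_) j <;>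
    simp [Matrix.mul_apply]

theorem det_consMatrix (b : R) (F : Matrix (Fin l) (Fin l) R) :
    (consMatrix b F).det = b * F.det := by
  rw [Matrix.det_succ_row_zero, Fin.sum_univ_succ, Finset.sum_eq_zero fun j _ => by simp]
  simp only [Fin.val_zero, pow_zero, one_mul, consMatrix_zero_zero, add_zero]
  congr 2

theorem MatEquiv.consMatrix {F G : Matrix (Fin l) (Fin m) R} (h : MatEquiv F G) (b : R) :
    MatEquiv (consMatrix b F) (consMatrix b G) := by
  obtain ⟨M, N, hM, hN, rfl⟩ := h
  refine ⟨_root_.consMatrix 1 M, _root_.consMatrix 1 N, ?_, ?_, ?_⟩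
  · rwa [det_consMatrix, one_mul]
  · rwa [det_consMatrix, one_mul]
  · rw [consMatrix_mul, consMatrix_mul, one_mul, mul_one]

theorem MatEquiv.trans {F G H : Matrix (Fin l) (Fin m) R} (h1 : MatEquiv F G)
    (h2 : MatEquiv G H) : MatEquiv F H := by
  obtain ⟨M, N, hM, hN, rfl⟩ := h1
  obtain ⟨M', N', hM', hN', rfl⟩ := h2
  refine ⟨M' * M, N * N', ?_, ?_, by simp only [Matrix.mul_assoc]⟩
  · rw [Matrix.det_mul]
    exact hM'.mul hM
  · rw [Matrix.det_mul]
    exact hN.mul hN'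

theorem minorIdeal_consMatrix {b : R} {F : Matrix (Fin l) (Fin m) R} (hb : ∀ i j, b ∣ F i j)
    (k : ℕ) : minorIdeal (k + 1) (consMatrix b F) = Ideal.span {b} * minorIdeal k F := by
  have hmem : ∀ {c d : R}, b ∣ c → d ∈ minorIdeal k F → c * d ∈ Ideal.span {b} * minorIdeal k F :=
    fun hc hd => Ideal.mul_mem_mul (Ideal.mem_span_singleton.2 hc) hd
  refine le_antisymm (minorIdeal_le_iff.2 fun ri ci hr hc => ?_) ?_
  · by_cases h0 : ∃ i₀, ri i₀ = 0
    · obtain ⟨i₀, hi₀⟩ := h0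
      rw [Matrix.det_succ_row _ i₀]
      refine Ideal.sum_mem _ fun j _ => ?_
      rw [Matrix.submatrix_apply, hi₀]
      by_cases hj : ci j = 0
      · have hr' : ∀ i, ∃ a, Fin.succ a = ri (i₀.succAbove i) := fun i =>
          Fin.exists_succ_eq.2 fun h => Fin.succAbove_ne i₀ i (hr (h.trans hi₀.symm))
        have hc' : ∀ i, ∃ a, Fin.succ a = ci (j.succAbove i) := fun i =>
          Fin.exists_succ_eq.2 fun h => Fin.succAbove_ne j i (hc (h.trans hj.symm))
        choose r hr' using hr'
        choose c hc' using hc'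
        have e : ((consMatrix b F).submatrix ri ci).submatrix i₀.succAbove j.succAbove =
            F.submatrix r c := by
          ext x y
          simp [← hr', ← hc']
        rw [hj, consMatrix_zero_zero, e, mul_assoc]
        exact Ideal.mul_mem_left _ _ (hmem dvd_rfl (det_submatrix_mem_minorIdeal F r c))
      · obtain ⟨a, ha⟩ := Fin.exists_succ_eq.2 hj
        rw [← ha, consMatrix_zero_succ, mul_zero, zero_mul]
        exact Ideal.zero_mem _
    · have hr' : ∀ i, ∃ a, Fin.succ a = ri i := fun i => Fin.exists_succ_eq.2 fun h => h0 ⟨i, h⟩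
      choose r hr' using hr'
      by_cases h1 : ∃ j₀, ci j₀ = 0
      · obtain ⟨j₀, hj₀⟩ := h1
        rw [Matrix.det_eq_zero_of_column_eq_zero j₀ fun i => by simp [hj₀, ← hr']]
        exact Ideal.zero_mem _
      · have hc' : ∀ i, ∃ a, Fin.succ a = ci i := fun i => Fin.exists_succ_eq.2 fun h => h1 ⟨i, h⟩
        choose c hc' using hc'
        have e : (consMatrix b F).submatrix ri ci = F.submatrix r c := by
          ext x y
          simp [← hr', ← hc']
        rw [e, Matrix.det_succ_row_zero]
        refine Ideal.sum_mem _ fun j _ => ?_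
        rw [mul_assoc]
        exact Ideal.mul_mem_left _ _ (hmem (hb _ _) (det_submatrix_mem_minorIdeal F _ _))
  · rw [minorIdeal, Ideal.span_mul_span', Ideal.span_le]
    rintro _ ⟨b', hb', _, ⟨ri, ci, -, -, rfl⟩, rfl⟩
    rw [Set.mem_singleton_iff.1 hb']
    change b * (F.submatrix ri ci).det ∈ _
    have e : consMatrix b (F.submatrix ri ci) = (consMatrix b F).submatrix
        (Fin.cons 0 (Fin.succ ∘ ri)) (Fin.cons 0 (Fin.succ ∘ ci)) := by
      ext i j
      refine Fin.cases ?_ (fun i => ?_) i <;> refine Fin.cases ?_ (fun j => ?_) j <;> simp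
    rw [← det_consMatrix, e]
    exact det_submatrix_mem_minorIdeal _ _ _

end MinorIdeal

section Idempotent

variable {R : Type*} [CommRing R] {l m : ℕ}

theorem det_submatrix_eq_zero_of_minorIdeal_succ {t : ℕ} {A : Matrix (Fin l) (Fin m) R}
    (h : minorIdeal (t + 1) A = ⊥) (ri : Fin t ⊕ Fin 1 → Fin l) (ci : Fin t ⊕ Fin 1 → Fin m) :
    (A.submatrix ri ci).det = 0 := by
  have := det_submatrix_mem_minorIdeal A (ri ∘ finSumFinEquiv.symm) (ci ∘ finSumFinEquiv.symm)
  rw [h, Ideal.mem_bot] at this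
  rw [← this, ← Matrix.submatrix_submatrix, Matrix.det_submatrix_equiv_self]

theorem mul_adjugate_mul_of_minorIdeal_succ [IsDomain R] {t : ℕ} {A : Matrix (Fin l) (Fin m) R}
    (h : minorIdeal (t + 1) A = ⊥) {α : Fin t → Fin l} {β : Fin t → Fin m}
    (hd : (A.submatrix α β).det ≠ 0) :
    A.submatrix id β * (A.submatrix α β).adjugate * A.submatrix α id =
      (A.submatrix α β).det • A := by
  ext i j
  set M := A.submatrix α β with hM
  set c : Matrix (Fin t) (Fin 1) R := A.submatrix α (fun _ => j) with hc
  set r : Matrix (Fin 1) (Fin t) R := A.submatrix (fun _ => i) β with hr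
  set a : Matrix (Fin 1) (Fin 1) R := A.submatrix (fun _ => i) (fun _ => j) with ha
  have h0 : (fromBlocks M c r a).det = 0 := by
    rw [← det_submatrix_eq_zero_of_minorIdeal_succ h (Sum.elim α fun _ => i)
      (Sum.elim β fun _ => j)]
    congr 1
    ext x y
    rcases x with x | x <;> rcases y with y | y <;> rfl
  have h1 : fromBlocks M c r a * fromBlocks 1 (-(M.adjugate * c)) 0 (M.det • 1) =
      fromBlocks M 0 r (M.det • a - r * M.adjugate * c) := by
    rw [fromBlocks_multiply]
    congr 1
    · simp
    · simp [← Matrix.mul_assoc, Matrix.mul_adjugate]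
    · simp
    · simp [← Matrix.mul_assoc]
      abel
  have h2 := congrArg Matrix.det h1
  rw [det_mul, h0, zero_mul, det_fromBlocks_zero₁₂] at h2
  have h3 := (mul_eq_zero.1 h2.symm).resolve_left hd
  rw [Matrix.det_fin_one, Matrix.sub_apply, sub_eq_zero] at h3
  exact h3.symm

theorem exists_idempotent_of_minorIdeal [IsDomain R] {t : ℕ} {A : Matrix (Fin l) (Fin m) R} {g : R}
    (hg : g ≠ 0) (ht : minorIdeal t A = Ideal.span {g}) (h : minorIdeal (t + 1) A = ⊥) :
    ∃ (P : Matrix (Fin l) (Fin l) R) (Y : Matrix (Fin m) (Fin l) R),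
      P * P = P ∧ P * A = A ∧ A * Y = g • P := by
  have key : ∀ x ∈ minorIdeal t A, ∃ (P : Matrix (Fin l) (Fin l) R) (Y : Matrix (Fin m) (Fin l) R),
      A * Y * A = x • A ∧ A * Y = g • P := by
    intro x hx
    refine Submodule.span_induction ?_ ?_ ?_ ?_ hx
    · rintro _ ⟨α, β, -, -, rfl⟩
      by_cases hd : (A.submatrix α β).det = 0
      · exact ⟨0, 0, by simp [hd], by simp⟩
      have hW : ∀ i a, ∃ w, (A.submatrix id β * (A.submatrix α β).adjugate) i a = g * w := by
        intro i a
        refine Ideal.mem_span_singleton.1 (ht ▸ ?_)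
        have := det_submatrix_mem_minorIdeal A (Function.update α a i) β
        convert this using 1
        have e : A.submatrix (Function.update α a i) β =
            (A.submatrix α β).updateRow a (fun b => A i (β b)) := by
          ext x y
          by_cases hx : x = a
          · subst hx; simp
          · simp [hx, Matrix.updateRow_ne]
        rw [e, ← Matrix.cramer_transpose_apply, Matrix.cramer_eq_adjugate_mulVec,
          ← Matrix.adjugate_transpose, Matrix.mulVec_transpose]
        rfl
      choose W hW using hW
      have e : A.submatrix id β * (A.submatrix α β).adjugate = g • Matrix.of W := by
        ext i a
        simp [hW]
      have e1 : A * ((1 : Matrix (Fin m) (Fin m) R).submatrix id β) = A.submatrix id β := by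
        ext x y
        simp [Matrix.mul_apply, Matrix.one_apply]
      have e2 : (1 : Matrix (Fin l) (Fin l) R).submatrix α id * A = A.submatrix α id := by
        ext x y
        simp [Matrix.mul_apply, Matrix.one_apply]
      refine ⟨Matrix.of W * (1 : Matrix (Fin l) (Fin l) R).submatrix α id,
        (1 : Matrix (Fin m) (Fin m) R).submatrix id β * (A.submatrix α β).adjugate *
          (1 : Matrix (Fin l) (Fin l) R).submatrix α id, ?_, ?_⟩
      · rw [← mul_adjugate_mul_of_minorIdeal_succ h hd, ← e1, ← e2]
        simp only [Matrix.mul_assoc]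
      · rw [← Matrix.smul_mul, ← e, ← e1]
        simp only [Matrix.mul_assoc]
    · exact ⟨0, 0, by simp, by simp⟩
    · rintro x y - - ⟨P, Y, h1, h2⟩ ⟨P', Y', h1', h2'⟩
      exact ⟨P + P', Y + Y', by rw [Matrix.mul_add, Matrix.add_mul, h1, h1', add_smul],
        by rw [Matrix.mul_add, h2, h2', smul_add]⟩
    · rintro a x - ⟨P, Y, h1, h2⟩
      exact ⟨a • P, a • Y, by rw [Matrix.mul_smul, Matrix.smul_mul, h1, smul_assoc],
        by rw [Matrix.mul_smul, h2, smul_comm]⟩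
  obtain ⟨P, Y, h1, h2⟩ := key g (ht ▸ Ideal.mem_span_singleton_self g)
  have h3 : P * A = A := smul_right_injective _ hg (by
    beta_reduce
    rw [← Matrix.smul_mul, ← h2, h1])
  refine ⟨P, Y, smul_right_injective _ hg ?_, h3, h2⟩
  beta_reduce
  rw [← Matrix.mul_smul, ← h2, ← Matrix.mul_assoc, h3]

theorem exists_rank_of_minorIdeal {A : Matrix (Fin l) (Fin m) R} {g : ℕ → R}
    (h : ∀ k ≤ l, minorIdeal k A = Ideal.span {g k}) (h0 : g 0 ≠ 0) :
    ∃ t ≤ l, g t ≠ 0 ∧ minorIdeal (t + 1) A = ⊥ := by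
  classical
  refine ⟨Nat.findGreatest (fun k => g k ≠ 0) l, Nat.findGreatest_le l,
    Nat.findGreatest_spec (P := fun k => g k ≠ 0) (Nat.zero_le l) h0, ?_⟩
  by_cases hl : Nat.findGreatest (fun k => g k ≠ 0) l + 1 ≤ l
  · have := Nat.findGreatest_is_greatest (P := fun k => g k ≠ 0) (Nat.lt_succ_self _) hl
    rw [h _ hl, not_not.1 this, Ideal.span_singleton_eq_bot]
  · exact minorIdeal_eq_bot_of_lt (not_le.1 hl) A

theorem exists_vecMul_eq_self_of_isSplitIdempotent [Nontrivial R] {N : ℕ}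
    {E : Matrix (Fin N) (Fin N) R} (h : IsSplitIdempotent E) (h0 : E ≠ 0) :
    ∃ u w : Fin N → R, u ᵥ* E = u ∧ u ⬝ᵥ w = 1 := by
  obtain ⟨r, s, U, V, h1, h2, h3⟩ := h
  have h4 : V * E = (fromBlocks 1 0 0 0 : Matrix (Fin r ⊕ Fin s) (Fin r ⊕ Fin s) R) * V := by
    rw [← h3, Matrix.mul_assoc _ U, h1, Matrix.mul_one]
  rcases r with _ | r
  · refine absurd ?_ h0
    have h5 : (fromBlocks 1 0 0 0 : Matrix (Fin 0 ⊕ Fin s) (Fin 0 ⊕ Fin s) R) = 0 := by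
      ext i j
      rcases i with i | i
      · exact i.elim0
      · rcases j with j | j <;> rfl
    rw [h5, Matrix.zero_mul] at h4
    rw [← Matrix.one_mul E, ← h1, Matrix.mul_assoc, h4, Matrix.mul_zero]
  · refine ⟨V (Sum.inl 0), fun i => U i (Sum.inl 0), ?_, ?_⟩
    · have h5 := congrFun h4 (Sum.inl 0)
      refine Eq.trans ?_ (h5.trans ?_)
      · rfl
      · ext j
        simp [Matrix.mul_apply, Matrix.one_apply]
    · have := congrFun (congrFun h2 (Sum.inl 0)) (Sum.inl 0)
      rwa [Matrix.one_apply_eq] at this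

theorem exists_completion_of_isSplitIdempotent [IsDomain R] {n : ℕ} {u w : Fin (n + 1) → R}
    (h : IsSplitIdempotent (vecMulVec w u)) (huw : u ⬝ᵥ w = 1) :
    ∃ G G' : Matrix (Fin (n + 1)) (Fin (n + 1)) R,
      G * G' = 1 ∧ G' * G = 1 ∧ (∀ j, G 0 j = u j) ∧ ∀ i, G' i 0 = w i := by
  obtain ⟨r, s, U, V, h1, h2, h3⟩ := h
  have hcard := Matrix.square_of_invertible U V h1 h2
  have hab : ∀ i j, (V *ᵥ w) i * (u ᵥ* U) j =
      (fromBlocks 1 0 0 0 : Matrix (Fin r ⊕ Fin s) (Fin r ⊕ Fin s) R) i j := by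
    intro i j
    rw [← h3, Matrix.mul_vecMulVec, Matrix.vecMulVec_mul, Matrix.vecMulVec_apply]
  have hsum : ∑ i, (u ᵥ* U) i * (V *ᵥ w) i = 1 := by
    change (u ᵥ* U) ⬝ᵥ (V *ᵥ w) = 1
    rw [Matrix.dotProduct_mulVec, Matrix.vecMul_vecMul, h1, Matrix.vecMul_one, huw]
  have hr : r = 1 := by
    rcases r with _ | _ | r
    · rw [Fintype.sum_sum_type] at hsum
      simp only [Finset.univ_eq_empty, Finset.sum_empty, zero_add] at hsum
      rw [Finset.sum_eq_zero] at hsum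
      · exact absurd hsum zero_ne_one
      · intro i _
        rw [mul_comm, hab]
        rfl
    · rfl
    · have h00 := hab (Sum.inl 0) (Sum.inl 0)
      have h11 := hab (Sum.inl 1) (Sum.inl 1)
      have h01 := hab (Sum.inl 0) (Sum.inl 1)
      simp only [fromBlocks_apply₁₁, Matrix.one_apply_eq] at h00 h11 h01
      rw [Matrix.one_apply_ne (by simp)] at h01
      rcases mul_eq_zero.1 h01 with h | h
      · rw [h, zero_mul] at h00
        exact absurd h00 zero_ne_one
      · rw [h, mul_zero] at h11
        exact absurd h11 zero_ne_one
  subst hr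
  have hs : s = n := by
    simp only [Fintype.card_fin, Fintype.card_sum] at hcard
    omega
  subst hs
  have hunit := hab (Sum.inl 0) (Sum.inl 0)
  simp only [fromBlocks_apply₁₁, Matrix.one_apply_eq] at hunit
  have hV : ∀ i, (V *ᵥ w) (Sum.inr i) = 0 := fun i =>
    (mul_eq_zero.1 (hab (Sum.inr i) (Sum.inl 0))).resolve_right (right_ne_zero_of_mul_eq_one hunit)
  have hU : ∀ i, (u ᵥ* U) (Sum.inr i) = 0 := fun i =>
    (mul_eq_zero.1 (hab (Sum.inl 0) (Sum.inr i))).resolve_left (left_ne_zero_of_mul_eq_one hunit)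
  have hG : (Matrix.of (Fin.cons u fun i => V (Sum.inr i)) :
      Matrix (Fin (s + 1)) (Fin (s + 1)) R) *
      (Matrix.of fun i => Fin.cons (w i) fun j => U i (Sum.inr j)) = 1 := by
    ext i j
    refine Fin.cases ?_ (fun i => ?_) i <;> refine Fin.cases ?_ (fun j => ?_) j
    · exact huw
    · exact (hU j).trans (Matrix.one_apply_ne (Fin.succ_ne_zero j).symm).symm
    · exact (hV i).trans (Matrix.one_apply_ne (Fin.succ_ne_zero i)).symm
    · refine (congrFun (congrFun h2 (Sum.inr i)) (Sum.inr j)).trans ?_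
      simp [Matrix.one_apply]
  exact ⟨_, _, hG, mul_eq_one_comm.1 hG, fun _ => rfl, fun _ => rfl⟩

end Idempotent

section SubstPair

/-- Two commuting retractions `ρ₁`, `ρ₂` of a ring, given by reduction modulo `d₁` and `d₂`. -/
structure SubstPair {R : Type*} [CommRing R] (ρ₁ ρ₂ : R →+* R) (d₁ d₂ : R) : Prop where
  idem₁ : ∀ x, ρ₁ (ρ₁ x) = ρ₁ x
  idem₂ : ∀ x, ρ₂ (ρ₂ x) = ρ₂ x
  comm : ∀ x, ρ₁ (ρ₂ x) = ρ₂ (ρ₁ x)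
  dvd₁ : ∀ x, d₁ ∣ x - ρ₁ x
  dvd₂ : ∀ x, d₂ ∣ x - ρ₂ x
  map₁₁ : ρ₁ d₁ = 0
  map₁₂ : ρ₁ d₂ = d₂
  map₂₁ : ρ₂ d₁ = d₁
  map₂₂ : ρ₂ d₂ = 0
  ne₁ : d₁ ≠ 0
  ne₂ : d₂ ≠ 0

variable {R : Type*} [CommRing R] {ρ₁ ρ₂ : R →+* R} {d₁ d₂ : R} {l m : ℕ}

theorem SubstPair.symm (h : SubstPair ρ₁ ρ₂ d₁ d₂) : SubstPair ρ₂ ρ₁ d₂ d₁ :=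
  ⟨h.idem₂, h.idem₁, fun x => (h.comm x).symm, h.dvd₂, h.dvd₁, h.map₂₂, h.map₂₁, h.map₁₂, h.map₁₁,
    h.ne₂, h.ne₁⟩

theorem vecMul_mem {I : Ideal R} {v : Fin l → R} (hv : ∀ i, v i ∈ I)
    (A : Matrix (Fin l) (Fin m) R) (j : Fin m) : (v ᵥ* A) j ∈ I := by
  simp only [Matrix.vecMul, dotProduct]
  exact Ideal.sum_mem _ fun i _ => Ideal.mul_mem_right _ _ (hv i)

theorem vecMul_mem_of_sub_mem {I : Ideal R} {v : Fin l → R} {A B : Matrix (Fin l) (Fin m) R}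
    (hAB : ∀ i j, A i j - B i j ∈ I) (hA : ∀ j, (v ᵥ* A) j ∈ I) (j : Fin m) : (v ᵥ* B) j ∈ I := by
  have h : (v ᵥ* B) j = (v ᵥ* A) j - (v ᵥ* (A - B)) j := by
    rw [Matrix.vecMul_sub, Pi.sub_apply, sub_sub_cancel]
  rw [h]
  refine Ideal.sub_mem _ (hA j) ?_
  simp only [Matrix.vecMul, dotProduct]
  exact Ideal.sum_mem _ fun i _ => Ideal.mul_mem_left _ _ (hAB i j)

theorem SubstPair.sub_map_mem (h : SubstPair ρ₁ ρ₂ d₁ d₂) {I : Ideal R} (hd : d₁ ∈ I)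
    (A : Matrix (Fin l) (Fin m) R) (i : Fin l) (j : Fin m) : A i j - A.map ρ₁ i j ∈ I :=
  Ideal.mem_of_dvd _ (h.dvd₁ _) hd

theorem SubstPair.mul_sub_mem (h : SubstPair ρ₁ ρ₂ d₁ d₂) {I : Ideal R} (hd : d₁ ∈ I)
    {H : Matrix (Fin l) (Fin l) R} (hH : H.map ρ₁ = 1) (A : Matrix (Fin l) (Fin m) R) (i : Fin l)
    (j : Fin m) : (H * A) i j - A i j ∈ I := by
  have hHA : H * A = A + (H - H.map ρ₁) * A := by
    rw [hH, Matrix.sub_mul, Matrix.one_mul, add_sub_cancel]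
  rw [hHA, Matrix.add_apply, add_sub_cancel_left]
  exact vecMul_mem (h.sub_map_mem hd H i) A j

/-- A vector killed modulo a prime ideal by a matrix some maximal minor of which does not lie in
that ideal vanishes modulo the ideal. -/
theorem mem_of_vecMul_mem {I : Ideal R} [I.IsPrime] {F : Matrix (Fin l) (Fin m) R}
    (hF : ¬ minorIdeal l F ≤ I) {v : Fin l → R} (hv : ∀ j, (v ᵥ* F) j ∈ I) (i : Fin l) : v i ∈ I := by
  by_contra hi
  refine hF (minorIdeal_le_iff.2 fun ri ci hr _ => ?_)
  set e := Equiv.ofBijective ri (Finite.injective_iff_bijective.1 hr)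
  have h1 : ∀ j, ((v ∘ ri) ᵥ* F.submatrix ri ci) j ∈ I := by
    intro j
    have h2 := Matrix.submatrix_vecMul_equiv F (v ∘ e) e ci
    rw [Function.comp_assoc, Equiv.self_comp_symm, Function.comp_id] at h2
    exact (congrFun h2 j).symm ▸ hv (ci j)
  have h3 := vecMul_mem h1 (F.submatrix ri ci).adjugate (e.symm i)
  rw [Matrix.vecMul_vecMul, Matrix.mul_adjugate, Matrix.vecMul_smul, Matrix.vecMul_one,
    Pi.smul_apply, smul_eq_mul, Function.comp_apply,
    show ri (e.symm i) = i from e.apply_symm_apply i] at h3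
  exact (Ideal.IsPrime.mem_or_mem inferInstance h3).resolve_right hi

/-- A `ρ₁`-invariant idempotent is conjugate to its reduction by `ρ₂`, by a matrix reducing to the
identity. -/
theorem SubstPair.exists_conj (h : SubstPair ρ₁ ρ₂ d₁ d₂) {N : ℕ} {P : Matrix (Fin N) (Fin N) R}
    (hP : IsSplitIdempotent P) (hP₁ : P.map ρ₁ = P) :
    ∃ H H' : Matrix (Fin N) (Fin N) R, H * H' = 1 ∧ H * P = P.map ρ₂ * H ∧ H.map ρ₂ = 1 := by
  obtain ⟨r, s, U, V, h1, h2, h3⟩ := hP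
  have h4 : V * P = (fromBlocks 1 0 0 0 : Matrix (Fin r ⊕ Fin s) (Fin r ⊕ Fin s) R) * V := by
    rw [← h3, Matrix.mul_assoc _ U, h1, Matrix.mul_one]
  have h5 : P * U = U * (fromBlocks 1 0 0 0 : Matrix (Fin r ⊕ Fin s) (Fin r ⊕ Fin s) R) := by
    rw [← h3, ← Matrix.mul_assoc, ← Matrix.mul_assoc, h1, Matrix.one_mul]
  have h6 := congrArg (fun A => A.map ρ₁) h4
  have h7 := congrArg (fun A => (A.map ρ₁).map ρ₂) h5
  beta_reduce at h6 h7
  simp only [Matrix.map_mul, hP₁, map_fromBlocks_one_zero] at h6 h7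
  have h8 := congrArg (fun A => A.map ρ₁) h2
  have h9 := congrArg (fun A => (A.map ρ₁).map ρ₂) h1
  beta_reduce at h8 h9
  simp only [Matrix.map_mul, Matrix.map_one _ ρ₁.map_zero ρ₁.map_one,
    Matrix.map_one _ ρ₂.map_zero ρ₂.map_one] at h8 h9
  refine ⟨(U.map ρ₁).map ρ₂ * V.map ρ₁, U.map ρ₁ * (V.map ρ₁).map ρ₂, ?_, ?_, ?_⟩
  · rw [Matrix.mul_assoc, ← Matrix.mul_assoc (V.map ρ₁), h8, Matrix.one_mul, h9]
  · rw [Matrix.mul_assoc, h6, ← Matrix.mul_assoc, ← Matrix.mul_assoc, h7]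
  · have h10 : ((U.map ρ₁).map ρ₂).map ρ₂ = (U.map ρ₁).map ρ₂ := by
      ext i j
      exact h.idem₂ _
    rw [Matrix.map_mul, h10, h9]

/-- The ideal condition on minors in the induction: all ideals of minors of order at most the number
of rows are generated by powers of `d₁` and `d₂`. -/
def HasMinorExponents (d₁ d₂ : R) (p q : ℕ → ℕ) (F : Matrix (Fin l) (Fin m) R) : Prop :=
  ∀ k ≤ l, minorIdeal k F = Ideal.span {d₁ ^ p k * d₂ ^ q k}

theorem HasMinorExponents.symm {p q : ℕ → ℕ} {F : Matrix (Fin l) (Fin m) R}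
    (h : HasMinorExponents d₁ d₂ p q F) : HasMinorExponents d₂ d₁ q p F :=
  fun k hk => by rw [h k hk, mul_comm]

theorem HasMinorExponents.map {p q : ℕ → ℕ} {F : Matrix (Fin l) (Fin m) R}
    (h : HasMinorExponents d₁ d₂ p q F) (ρ : R →+* R) :
    HasMinorExponents (ρ d₁) (ρ d₂) p q (F.map ρ) := fun k hk => by
  rw [minorIdeal_map, h k hk, Ideal.map_span, Set.image_singleton, map_mul, map_pow, map_pow]

theorem SubstPair.exists_side [IsDomain R]
    (hQS : ∀ {N : ℕ} {E : Matrix (Fin N) (Fin N) R}, E * E = E → IsSplitIdempotent E)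
    (h : SubstPair ρ₁ ρ₂ d₁ d₂) {p q : ℕ → ℕ} {F : Matrix (Fin l) (Fin m) R} (hp : p 0 = 0)
    (hF : HasMinorExponents d₁ d₂ p q F) :
    ∃ H H' : Matrix (Fin l) (Fin l) R, H * H' = 1 ∧ H.map ρ₂ = 1 ∧
      ∀ (I : Ideal R) [I.IsPrime], d₁ ∈ I → d₂ ∉ I → ∀ v : Fin l → R,
        (∀ j, (v ᵥ* H ᵥ* F) j ∈ I) → ∀ j, (v ᵥ* (F.map ρ₁).map ρ₂) j ∈ I := by
  have hF₁ := hF.map ρ₁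
  rw [h.map₁₁, h.map₁₂] at hF₁
  obtain ⟨t, ht, hg, hmin⟩ := exists_rank_of_minorIdeal hF₁
    (by rw [hp, pow_zero, one_mul]; exact pow_ne_zero _ h.ne₂)
  obtain ⟨P, Y, hPP, hPA, hAY⟩ := exists_idempotent_of_minorIdeal hg (hF₁ t ht) hmin
  have hg' : (0 : R) ^ p t * d₂ ^ q t = d₂ ^ q t := by
    rcases Nat.eq_zero_or_pos (p t) with h0 | h0
    · rw [h0, pow_zero, one_mul]
    · rw [zero_pow h0.ne', zero_mul] at hg
      exact absurd rfl hg
  rw [hg'] at hAY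
  have hFF : (F.map ρ₁).map ρ₁ = F.map ρ₁ := by
    ext i j
    exact h.idem₁ _
  have hPP₁ : (P.map ρ₁).map ρ₁ = P.map ρ₁ := by
    ext i j
    exact h.idem₁ _
  have hPP' : P.map ρ₁ * P.map ρ₁ = P.map ρ₁ := by rw [← Matrix.map_mul, hPP]
  have hPA' : P.map ρ₁ * F.map ρ₁ = F.map ρ₁ := by
    conv_lhs => rw [← hFF, ← Matrix.map_mul, hPA, hFF]
  have hAY' : F.map ρ₁ * Y.map ρ₁ = d₂ ^ q t • P.map ρ₁ := by
    conv_lhs => rw [← hFF, ← Matrix.map_mul, hAY]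
    ext i j
    simp [h.map₁₂]
  obtain ⟨H, H', hH, hHP, hH₂⟩ := h.exists_conj (hQS hPP') hPP₁
  refine ⟨H, H', hH, hH₂, fun I _ hd₁ hd₂ v hv => ?_⟩
  have h1 := vecMul_mem_of_sub_mem (h.sub_map_mem hd₁ F) hv
  have h2 := vecMul_mem h1 (Y.map ρ₁)
  rw [Matrix.vecMul_vecMul, hAY', Matrix.vecMul_smul, Matrix.vecMul_vecMul, hHP] at h2
  have h3 : ∀ j, (v ᵥ* ((P.map ρ₁).map ρ₂ * H)) j ∈ I := fun j =>
    (Ideal.IsPrime.mem_or_mem inferInstance (h2 j)).resolve_left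
      fun h => hd₂ (Ideal.IsPrime.mem_of_pow_mem inferInstance _ h)
  have h4 := vecMul_mem h3 (H' * (F.map ρ₁).map ρ₂)
  have h5 : (P.map ρ₁).map ρ₂ * H * (H' * (F.map ρ₁).map ρ₂) = (F.map ρ₁).map ρ₂ := by
    rw [Matrix.mul_assoc, ← Matrix.mul_assoc H, hH, Matrix.one_mul, ← Matrix.map_mul, hPA']
  rwa [Matrix.vecMul_vecMul, h5] at h4

theorem minorIdeal_one_zero : minorIdeal 1 (0 : Matrix (Fin l) (Fin m) R) = ⊥ :=
  le_bot_iff.1 (minorIdeal_le_iff.2 fun ri ci _ _ => by simp)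

theorem HasMinorExponents.exists_vecMul_eq [IsDomain R]
    (hQS : ∀ {N : ℕ} {E : Matrix (Fin N) (Fin N) R}, E * E = E → IsSplitIdempotent E)
    {p q : ℕ → ℕ} {F : Matrix (Fin (l + 1)) (Fin m) R} (hp : p 0 = 0) (hq : q 0 = 0)
    (hp1 : p 1 = 0) (hq1 : q 1 = 0) (hF : HasMinorExponents 0 0 p q F) :
    ∃ (u w : Fin (l + 1) → R) (Y : Matrix (Fin m) (Fin (l + 1)) R),
      u ᵥ* F ᵥ* Y = u ∧ u ⬝ᵥ w = 1 := by
  obtain ⟨t, ht, hg, hmin⟩ := exists_rank_of_minorIdeal hF (by simp [hp, hq])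
  obtain ⟨P, Y, hPP, hPA, hAY⟩ := exists_idempotent_of_minorIdeal hg (hF t ht) hmin
  have hg' : (0 : R) ^ p t * 0 ^ q t = 1 := by
    rw [← pow_add] at hg ⊢
    rcases Nat.eq_zero_or_pos (p t + q t) with h0 | h0
    · rw [h0, pow_zero]
    · rw [zero_pow h0.ne'] at hg
      exact absurd rfl hg
  have hP0 : P ≠ 0 := by
    rintro rfl
    have h1 := hF 1 (by omega)
    rw [← hPA, Matrix.zero_mul, minorIdeal_one_zero, hp1, hq1, pow_zero, one_mul, eq_comm,
      Ideal.span_singleton_eq_bot] at h1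
    exact one_ne_zero h1
  obtain ⟨u, w, hu, hw⟩ := exists_vecMul_eq_self_of_isSplitIdempotent (hQS hPP) hP0
  refine ⟨u, w, Y, ?_, hw⟩
  rw [Matrix.vecMul_vecMul, hAY, hg', one_smul, hu]

/-- If the entries of `F` generate the unit ideal modulo the pair, then some combination of its rows
is unimodular. -/
theorem SubstPair.exists_dotProduct_eq_one [IsDomain R]
    (hQS : ∀ {N : ℕ} {E : Matrix (Fin N) (Fin N) R}, E * E = E → IsSplitIdempotent E)
    (h : SubstPair ρ₁ ρ₂ d₁ d₂) {p q : ℕ → ℕ} {F : Matrix (Fin (l + 1)) (Fin m) R} (hp : p 0 = 0)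
    (hq : q 0 = 0) (hp1 : p 1 = 0) (hq1 : q 1 = 0) (hF : HasMinorExponents d₁ d₂ p q F) :
    ∃ (u : Fin (l + 1) → R) (v : Fin m → R), (u ᵥ* F) ⬝ᵥ v = 1 := by
  obtain ⟨H, H', hH, hH₂, hside⟩ := h.exists_side hQS hp hF
  obtain ⟨L, L', hL, hL₁, lside⟩ := h.symm.exists_side hQS hq hF.symm
  have hF₀ := (hF.map ρ₁).map ρ₂
  rw [h.map₁₁, map_zero, h.map₁₂, h.map₂₂] at hF₀
  obtain ⟨u, w, Y, hu, hw⟩ := hF₀.exists_vecMul_eq hQS hp hq hp1 hq1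
  have hcomm : (F.map ρ₂).map ρ₁ = (F.map ρ₁).map ρ₂ := by
    ext i j
    exact h.comm _
  rw [hcomm] at lside
  have hne : ∀ I : Ideal R, I ≠ ⊤ → ¬ ∀ i, u i ∈ I := by
    intro I hI hu
    refine hI ((Ideal.eq_top_iff_one I).2 ?_)
    rw [← hw]
    exact Ideal.sum_mem _ fun i _ => Ideal.mul_mem_right _ _ (hu i)
  have hne' : ∀ I : Ideal R, I ≠ ⊤ → ¬ ∀ j, (u ᵥ* (F.map ρ₁).map ρ₂) j ∈ I := by
    intro I hI h
    refine hne I hI ?_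
    rw [← hu]
    exact vecMul_mem h Y
  have htop : Ideal.span (Set.range (u ᵥ* H ᵥ* L ᵥ* F)) = ⊤ := by
    by_contra hcon
    obtain ⟨I, hI, hle⟩ := Ideal.exists_le_maximal _ hcon
    have hprime := hI.isPrime
    have hmem : ∀ j, (u ᵥ* H ᵥ* L ᵥ* F) j ∈ I := fun j => hle (Ideal.subset_span ⟨j, rfl⟩)
    rw [Matrix.vecMul_vecMul, Matrix.vecMul_vecMul] at hmem
    by_cases h1 : d₁ ∈ I
    · have hmem1 : ∀ j, (u ᵥ* (H * F)) j ∈ I := by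
        rw [← Matrix.vecMul_vecMul] at hmem ⊢
        exact vecMul_mem_of_sub_mem (h.mul_sub_mem h1 hL₁ F) hmem
      by_cases h2 : d₂ ∈ I
      · exact hne' I hI.ne_top (vecMul_mem_of_sub_mem (h.symm.sub_map_mem h2 _)
          (vecMul_mem_of_sub_mem (h.sub_map_mem h1 _)
            (vecMul_mem_of_sub_mem (h.symm.mul_sub_mem h2 hH₂ F) hmem1)))
      · rw [← Matrix.vecMul_vecMul] at hmem1
        exact hne' I hI.ne_top (hside I h1 h2 u hmem1)
    · by_cases h2 : d₂ ∈ I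
      · refine hne' I hI.ne_top (lside I h2 h1 u ?_)
        rw [Matrix.vecMul_vecMul]
        exact vecMul_mem_of_sub_mem (h.symm.mul_sub_mem h2 hH₂ _) hmem
      · refine hne I hI.ne_top ?_
        rw [← Matrix.mul_assoc, ← Matrix.vecMul_vecMul] at hmem
        have h3 := vecMul_mem (mem_of_vecMul_mem ?_ hmem) (L' * H')
        · rwa [Matrix.vecMul_vecMul, Matrix.mul_assoc, ← Matrix.mul_assoc L, hL, Matrix.one_mul, hH,
            Matrix.vecMul_one] at h3
        · rw [hF _ le_rfl, Ideal.span_singleton_le_iff_mem]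
          intro h3
          rcases Ideal.IsPrime.mem_or_mem inferInstance h3 with h3 | h3
          · exact h1 (Ideal.IsPrime.mem_of_pow_mem inferInstance _ h3)
          · exact h2 (Ideal.IsPrime.mem_of_pow_mem inferInstance _ h3)
  rw [Ideal.eq_top_iff_one, Ideal.mem_span_range_iff_exists_fun] at htop
  obtain ⟨c, hc⟩ := htop
  refine ⟨u ᵥ* H ᵥ* L, c, ?_⟩
  rw [dotProduct_comm]
  exact hc

end SubstPair

section SmithForm

variable {R : Type*} [CommRing R] [IsDomain R] {ρ₁ ρ₂ : R →+* R} {d₁ d₂ : R} {l m : ℕ}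

theorem SubstPair.le_of_dvd (h : SubstPair ρ₁ ρ₂ d₁ d₂) {a b a' b' : ℕ}
    (hdvd : d₁ ^ a * d₂ ^ b ∣ d₁ ^ a' * d₂ ^ b') : a ≤ a' := by
  by_contra hlt
  obtain ⟨c, rfl⟩ := Nat.exists_eq_add_of_lt (not_le.1 hlt)
  rw [add_assoc, pow_add, mul_assoc, mul_dvd_mul_iff_left (pow_ne_zero _ h.ne₁)] at hdvd
  have h1 := map_dvd ρ₁ hdvd
  rw [map_mul, map_pow, map_pow, map_pow, h.map₁₁, h.map₁₂, pow_succ, mul_zero, zero_mul,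
    zero_dvd_iff] at h1
  exact pow_ne_zero _ h.ne₂ h1

theorem SubstPair.le_and_le_of_dvd (h : SubstPair ρ₁ ρ₂ d₁ d₂) {a b a' b' : ℕ}
    (hdvd : d₁ ^ a * d₂ ^ b ∣ d₁ ^ a' * d₂ ^ b') : a ≤ a' ∧ b ≤ b' :=
  ⟨h.le_of_dvd hdvd, h.symm.le_of_dvd (by rwa [mul_comm, mul_comm (d₂ ^ b')])⟩

/-- The diagonal matrix with entries the successive quotients of `d₁ ^ p k * d₂ ^ q k`. -/
def smithForm (d₁ d₂ : R) (p q : ℕ → ℕ) (l m : ℕ) : Matrix (Fin l) (Fin m) R :=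
  Matrix.of fun i j => if (i : ℕ) = (j : ℕ) then
    d₁ ^ (p ((i : ℕ) + 1) - p (i : ℕ)) * d₂ ^ (q ((i : ℕ) + 1) - q (i : ℕ)) else 0

theorem dvd_of_span_singleton_mul_eq {S : Type*} [CommRing S] {a c : S} {I : Ideal S}
    (h : Ideal.span {a} * I = Ideal.span {c}) : a ∣ c :=
  Ideal.span_singleton_le_span_singleton.1 (h ▸ Ideal.mul_le_left)

theorem exists_completion (hQS : ∀ {N : ℕ} {E : Matrix (Fin N) (Fin N) R}, E * E = E →
    IsSplitIdempotent E) {n : ℕ} {u w : Fin (n + 1) → R} (huw : u ⬝ᵥ w = 1) :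
    ∃ G G' : Matrix (Fin (n + 1)) (Fin (n + 1)) R,
      G * G' = 1 ∧ G' * G = 1 ∧ (∀ j, G 0 j = u j) ∧ ∀ i, G' i 0 = w i := by
  refine exists_completion_of_isSplitIdempotent (hQS ?_) huw
  rw [Matrix.vecMulVec_mul_vecMulVec, huw, one_smul]

theorem matEquiv_consMatrix_of_dotProduct_eq_one
    (hQS : ∀ {N : ℕ} {E : Matrix (Fin N) (Fin N) R}, E * E = E → IsSplitIdempotent E)
    {F : Matrix (Fin (l + 1)) (Fin (m + 1)) R} {u : Fin (l + 1) → R} {v : Fin (m + 1) → R}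
    (h : (u ᵥ* F) ⬝ᵥ v = 1) :
    ∃ (M : Matrix (Fin (l + 1)) (Fin (l + 1)) R) (N : Matrix (Fin (m + 1)) (Fin (m + 1)) R)
      (F' : Matrix (Fin l) (Fin m) R), IsUnit M.det ∧ IsUnit N.det ∧
        M * F * N = consMatrix 1 F' := by
  have h' : u ⬝ᵥ (F *ᵥ v) = 1 := by rw [Matrix.dotProduct_mulVec, h]
  obtain ⟨M, M', hM, hM', hMu, hMv⟩ := exists_completion hQS h'
  obtain ⟨N', N, hN, hN', hNu, hNv⟩ := exists_completion hQS h
  refine ⟨M, N, Matrix.of fun i j => (M * F * N) i.succ j.succ,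
    Matrix.isUnit_det_of_right_inverse hM, Matrix.isUnit_det_of_right_inverse hN', ?_⟩
  have hrow : ∀ j, (M * F * N) 0 j = (1 : Matrix (Fin (m + 1)) (Fin (m + 1)) R) 0 j := by
    intro j
    rw [← hN, Matrix.mul_apply, Matrix.mul_apply]
    refine Finset.sum_congr rfl fun k _ => ?_
    rw [hNu, Matrix.mul_apply]
    simp only [hMu]
    rfl
  have hcol : ∀ i, (M * F * N) i 0 = (1 : Matrix (Fin (l + 1)) (Fin (l + 1)) R) i 0 := by
    intro i
    rw [← hM, Matrix.mul_assoc, Matrix.mul_apply, Matrix.mul_apply]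
    refine Finset.sum_congr rfl fun k _ => ?_
    rw [hMv, Matrix.mul_apply]
    simp only [hNv]
    rfl
  ext i j
  refine Fin.cases ?_ (fun i => ?_) i
  · rw [hrow]
    refine Fin.cases ?_ (fun j => ?_) j
    · simp
    · simp [(Fin.succ_ne_zero j).symm]
  · refine Fin.cases ?_ (fun j => ?_) j
    · rw [hcol]
      simp
    · rfl

theorem SubstPair.matEquiv_smithForm
    (hQS : ∀ {N : ℕ} {E : Matrix (Fin N) (Fin N) R}, E * E = E → IsSplitIdempotent E)
    (h : SubstPair ρ₁ ρ₂ d₁ d₂) : ∀ {l m : ℕ} {p q : ℕ → ℕ} {F : Matrix (Fin l) (Fin m) R},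
      p 0 = 0 → q 0 = 0 → HasMinorExponents d₁ d₂ p q F → MatEquiv F (smithForm d₁ d₂ p q l m) := by
  have hne : ∀ a b, d₁ ^ a * d₂ ^ b ≠ 0 := fun a b =>
    mul_ne_zero (pow_ne_zero _ h.ne₁) (pow_ne_zero _ h.ne₂)
  intro l
  induction l with
  | zero =>
    intro m p q F _ _ _
    exact ⟨1, 1, by simp, by simp, Subsingleton.elim _ _⟩
  | succ l ih =>
    intro m p q F hp hq hF
    rcases m with _ | m
    · have h1 := hF 1 (by omega)
      rw [← minorIdeal_transpose, minorIdeal_eq_bot_of_lt zero_lt_one, eq_comm,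
        Ideal.span_singleton_eq_bot] at h1
      exact absurd h1 (hne _ _)
    set b := d₁ ^ p 1 * d₂ ^ q 1 with hb
    have hbF : ∀ i j, b ∣ F i j := fun i j =>
      Ideal.mem_span_singleton.1 (hF 1 (by omega) ▸ apply_mem_minorIdeal_one F i j)
    choose A hA using hbF
    have hFA : F = b • (Matrix.of A) := by
      ext i j
      exact hA i j
    have hbk : ∀ k, b ^ k = d₁ ^ (k * p 1) * d₂ ^ (k * q 1) := fun k => by
      rw [hb, mul_pow, ← pow_mul, ← pow_mul, mul_comm k, mul_comm k]
    have hAexp : HasMinorExponents d₁ d₂ (fun k => p k - k * p 1) (fun k => q k - k * q 1)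
        (Matrix.of A) := by
      intro k hk
      have h1 := hF k hk
      rw [hFA, minorIdeal_smul] at h1
      have h2 : b ^ k ∣ d₁ ^ p k * d₂ ^ q k :=
        dvd_of_span_singleton_mul_eq h1
      rw [hbk] at h2
      obtain ⟨h3, h4⟩ := h.le_and_le_of_dvd h2
      rw [← Ideal.span_singleton_mul_right_inj (hne (k * p 1) (k * q 1)), ← hbk, h1, hbk,
        Ideal.span_singleton_mul_span_singleton, mul_mul_mul_comm, ← pow_add, ← pow_add,
        Nat.add_sub_cancel' h3, Nat.add_sub_cancel' h4]
    obtain ⟨u, v, huv⟩ := h.exists_dotProduct_eq_one hQS (by simp [hp]) (by simp [hq]) (by simp)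
      (by simp) hAexp
    obtain ⟨M, N, B, hM, hN, hMN⟩ := matEquiv_consMatrix_of_dotProduct_eq_one hQS huv
    have hcons : consMatrix b (b • B) = M * F * N := by
      rw [hFA, Matrix.mul_smul, Matrix.smul_mul, hMN]
      ext i j
      refine Fin.cases ?_ (fun i => ?_) i <;> refine Fin.cases ?_ (fun j => ?_) j <;> simp
    have hequiv : MatEquiv F (consMatrix b (b • B)) := ⟨M, N, hM, hN, hcons⟩
    have hbB : ∀ i j, b ∣ (b • B) i j := fun i j => Dvd.intro _ rfl
    have hle : ∀ k, k ≤ l → p 1 ≤ p (k + 1) ∧ q 1 ≤ q (k + 1) ∧ minorIdeal k (b • B) =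
        Ideal.span {d₁ ^ (p (k + 1) - p 1) * d₂ ^ (q (k + 1) - q 1)} := by
      intro k hk
      have h1 := hF (k + 1) (by omega)
      rw [← minorIdeal_eq_of_matEquiv hequiv,
        minorIdeal_consMatrix hbB] at h1
      have h2 : b ∣ d₁ ^ p (k + 1) * d₂ ^ q (k + 1) :=
        dvd_of_span_singleton_mul_eq h1
      obtain ⟨h3, h4⟩ := h.le_and_le_of_dvd h2
      refine ⟨h3, h4, ?_⟩
      rw [← Ideal.span_singleton_mul_right_inj (hne (p 1) (q 1)), ← hb, h1, hb,
        Ideal.span_singleton_mul_span_singleton, mul_mul_mul_comm, ← pow_add, ← pow_add,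
        Nat.add_sub_cancel' h3, Nat.add_sub_cancel' h4]
    have hrec := ih (p := fun k => p (k + 1) - p 1) (q := fun k => q (k + 1) - q 1)
      (F := b • B) (by simp) (by simp) fun k hk => (hle k hk).2.2
    refine hequiv.trans ?_
    convert hrec.consMatrix b using 1
    ext i j
    refine Fin.cases ?_ (fun i => ?_) i <;> refine Fin.cases ?_ (fun j => ?_) j
    · simp [smithForm, hp, hq, hb]
    · simp [smithForm]
    · simp [smithForm]
    · have h1 := hle i (by omega)
      have e1 : p (i + 1 + 1) - p 1 - (p (i + 1) - p 1) = p (i + 1 + 1) - p (i + 1) := by omega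
      have e2 : q (i + 1 + 1) - q 1 - (q (i + 1) - q 1) = q (i + 1 + 1) - q (i + 1) := by omega
      simp [smithForm, e1, e2]

end SmithForm

section Substitution

variable {K : Type*} [Field K] {n : ℕ}

theorem algHom_eq_of_mem_supported {A : Type*} [CommRing A] [Algebra K A] {s : Set (Fin n)}
    {φ ψ : MvPolynomial (Fin n) K →ₐ[K] A} (h : ∀ i ∈ s, φ (X i) = ψ (X i))
    {f : MvPolynomial (Fin n) K} (hf : f ∈ supported K s) : φ f = ψ f := by
  refine AlgHom.eqOn_adjoin_iff.2 ?_ hf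
  rintro _ ⟨i, hi, rfl⟩
  exact h i hi

theorem dvd_sub_of_forall_X {d : MvPolynomial (Fin n) K}
    {φ : MvPolynomial (Fin n) K →ₐ[K] MvPolynomial (Fin n) K}
    (h : ∀ i, d ∣ X i - φ (X i)) (f : MvPolynomial (Fin n) K) : d ∣ f - φ f := by
  have hφ : Ideal.Quotient.mkₐ K (Ideal.span {d}) =
      (Ideal.Quotient.mkₐ K (Ideal.span {d})).comp φ :=
    MvPolynomial.algHom_ext fun i =>
      Ideal.Quotient.eq.2 (Ideal.mem_span_singleton.2 (h i))
  exact Ideal.mem_span_singleton.1 (Ideal.Quotient.eq.1 (AlgHom.congr_fun hφ f))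

theorem X_sub_ne_zero_of_mem_supported {v : Fin n} {s : Set (Fin n)} (hv : v ∉ s)
    {f : MvPolynomial (Fin n) K} (hf : f ∈ supported K s) : X v - f ≠ 0 := by
  intro h
  rw [← sub_eq_zero.1 h, MvPolynomial.X_mem_supported] at hf
  exact hv hf

theorem exists_substPair {v1 v2 : Fin n} (hv : v1 ≠ v2) {f1 f2 : MvPolynomial (Fin n) K}
    (hf1 : f1 ∈ supported K (({v1} : Set (Fin n))ᶜ))
    (hf2 : f2 ∈ supported K (({v1, v2} : Set (Fin n))ᶜ)) :
    ∃ ρ₁ ρ₂ : MvPolynomial (Fin n) K →+* MvPolynomial (Fin n) K,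
      SubstPair ρ₁ ρ₂ (X v1 - f1) (X v2 - f2) := by
  set τ : MvPolynomial (Fin n) K →ₐ[K] MvPolynomial (Fin n) K :=
    aeval (Function.update X v2 f2) with hτ
  set ρ₁ : MvPolynomial (Fin n) K →ₐ[K] MvPolynomial (Fin n) K :=
    aeval (Function.update X v1 f1) with hρ₁
  set ρ₂ : MvPolynomial (Fin n) K →ₐ[K] MvPolynomial (Fin n) K :=
    aeval (Function.update (Function.update X v2 f2) v1 (X v1 - f1 + τ f1)) with hρ₂
  have τ2 : τ (X v2) = f2 := by simp [hτ]
  have τi : ∀ i, i ≠ v2 → τ (X i) = X i := fun i hi => by simp [hτ, hi]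
  have ρ1 : ρ₁ (X v1) = f1 := by simp [hρ₁]
  have ρi : ∀ i, i ≠ v1 → ρ₁ (X i) = X i := fun i hi => by simp [hρ₁, hi]
  have σ1 : ρ₂ (X v1) = X v1 - f1 + τ f1 := by simp [hρ₂]
  have σ2 : ρ₂ (X v2) = f2 := by simp [hρ₂, hv.symm]
  have σi : ∀ i, i ≠ v1 → i ≠ v2 → ρ₂ (X i) = X i := fun i hi hi' => by simp [hρ₂, hi, hi']
  have ρf1 : ρ₁ f1 = f1 := algHom_eq_of_mem_supported (ψ := AlgHom.id K _) (fun i hi => ρi i hi) hf1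
  have ρf2 : ρ₁ f2 = f2 := algHom_eq_of_mem_supported (ψ := AlgHom.id K _)
    (s := ({v1, v2} : Set (Fin n))ᶜ) (fun i hi => ρi i fun h => hi (Or.inl h)) hf2
  have σf1 : ρ₂ f1 = τ f1 := algHom_eq_of_mem_supported (fun i hi => by
    by_cases hi2 : i = v2
    · rw [hi2, σ2, τ2]
    · rw [σi i hi hi2, τi i hi2]) hf1
  have σf2 : ρ₂ f2 = f2 := algHom_eq_of_mem_supported (ψ := AlgHom.id K _)
    (s := ({v1, v2} : Set (Fin n))ᶜ) (fun i hi => σi i (fun h => hi (Or.inl h)) fun h => hi (Or.inr h)) hf2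
  have ρτ : ρ₁ (τ f1) = τ f1 := algHom_eq_of_mem_supported (φ := ρ₁.comp τ) (fun i hi => by
    rw [AlgHom.comp_apply]
    by_cases hi2 : i = v2
    · rw [hi2, τ2, ρf2]
    · rw [τi i hi2, ρi i hi]) hf1
  have στ : ρ₂ (τ f1) = τ f1 := algHom_eq_of_mem_supported (φ := ρ₂.comp τ) (fun i hi => by
    rw [AlgHom.comp_apply]
    by_cases hi2 : i = v2
    · rw [hi2, τ2, σf2]
    · rw [τi i hi2, σi i hi hi2]) hf1
  have dτ : ∀ x, X v2 - f2 ∣ x - τ x := dvd_sub_of_forall_X fun i => by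
    by_cases hi2 : i = v2
    · rw [hi2, τ2]
    · rw [τi i hi2, sub_self]
      exact dvd_zero _
  refine ⟨ρ₁, ρ₂, ?_, ?_, ?_, ?_, ?_, ?_, ?_, ?_, ?_, ?_, ?_⟩
  · refine AlgHom.congr_fun (φ₁ := ρ₁.comp ρ₁) (φ₂ := ρ₁)
      (MvPolynomial.algHom_ext fun i => ?_)
    rw [AlgHom.comp_apply]
    by_cases hi : i = v1
    · rw [hi, ρ1, ρf1]
    · rw [ρi i hi, ρi i hi]
  · refine AlgHom.congr_fun (φ₁ := ρ₂.comp ρ₂) (φ₂ := ρ₂)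
      (MvPolynomial.algHom_ext fun i => ?_)
    rw [AlgHom.comp_apply]
    by_cases hi : i = v1
    · rw [hi, σ1, map_add, map_sub, σ1, σf1, στ]
      ring
    · by_cases hi2 : i = v2
      · rw [hi2, σ2, σf2]
      · rw [σi i hi hi2, σi i hi hi2]
  · refine AlgHom.congr_fun (φ₁ := ρ₁.comp ρ₂) (φ₂ := ρ₂.comp ρ₁)
      (MvPolynomial.algHom_ext fun i => ?_)
    rw [AlgHom.comp_apply, AlgHom.comp_apply]
    by_cases hi : i = v1
    · rw [hi, σ1, map_add, map_sub, ρ1, ρf1, ρτ, σf1]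
      ring
    · by_cases hi2 : i = v2
      · rw [hi2, ρi _ hv.symm, σ2, ρf2]
      · rw [σi i hi hi2, ρi i hi, σi i hi hi2]
  · refine dvd_sub_of_forall_X (φ := ρ₁) fun i => ?_
    by_cases hi : i = v1
    · rw [hi, ρ1]
    · rw [ρi i hi, sub_self]
      exact dvd_zero _
  · refine dvd_sub_of_forall_X (φ := ρ₂) fun i => ?_
    by_cases hi : i = v1
    · rw [hi, σ1, sub_add_eq_sub_sub, sub_sub_cancel]
      exact dτ f1
    · by_cases hi2 : i = v2
      · rw [hi2, σ2]
      · rw [σi i hi hi2, sub_self]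
        exact dvd_zero _
  · exact (map_sub ρ₁ _ _).trans (by rw [ρ1, ρf1, sub_self])
  · exact (map_sub ρ₁ _ _).trans (by rw [ρi _ hv.symm, ρf2])
  · exact (map_sub ρ₂ _ _).trans (by rw [σ1, σf1, add_sub_cancel_right])
  · exact (map_sub ρ₂ _ _).trans (by rw [σ2, σf2, sub_self])
  · exact X_sub_ne_zero_of_mem_supported (by simp) hf1
  · exact X_sub_ne_zero_of_mem_supported (by simp) hf2

end Substitution

section Gcd

variable {R : Type*} [CommRing R] {l m : ℕ}

theorem IsGcdMinors.of_associated {k : ℕ} {F : Matrix (Fin l) (Fin m) R} {d e : R}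
    (h : IsGcdMinors k F d) (hde : Associated d e) : IsGcdMinors k F e :=
  ⟨fun a ha => hde.symm.dvd.trans (h.1 a ha), fun x hx => (h.2 x hx).trans hde.dvd⟩

theorem IsGcdMinors.minorIdeal_le {k : ℕ} {F : Matrix (Fin l) (Fin m) R} {d : R}
    (h : IsGcdMinors k F d) : minorIdeal k F ≤ Ideal.span {d} :=
  Ideal.span_le.2 fun a ha => Ideal.mem_span_singleton.2 (h.1 a ha)

theorem exists_isGcdMinors [IsDomain R] [UniqueFactorizationMonoid R] (k : ℕ)
    (F : Matrix (Fin l) (Fin m) R) : ∃ d, IsGcdMinors k F d := by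
  classical
  let _ : NormalizedGCDMonoid R := Classical.choice inferInstance
  refine ⟨(Finset.univ : Finset ((Fin k → Fin l) × (Fin k → Fin m))).gcd
    fun x => if Function.Injective x.1 ∧ Function.Injective x.2 then
      (F.submatrix x.1 x.2).det else 0, ?_, ?_⟩
  · rintro _ ⟨ri, ci, hr, hc, rfl⟩
    have := Finset.gcd_dvd (f := fun x : (Fin k → Fin l) × (Fin k → Fin m) =>
      if Function.Injective x.1 ∧ Function.Injective x.2 then
        (F.submatrix x.1 x.2).det else 0) (Finset.mem_univ (ri, ci))
    rwa [if_pos ⟨hr, hc⟩] at this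
  · intro e he
    refine Finset.dvd_gcd fun x _ => ?_
    split_ifs with h
    · exact he _ ⟨x.1, x.2, h.1, h.2, rfl⟩
    · exact dvd_zero _

theorem JEqTop.exists_minorIdeal_eq {k : ℕ} {F : Matrix (Fin l) (Fin m) R} (h : JEqTop k F) :
    ∃ d, IsGcdMinors k F d ∧ minorIdeal k F = Ideal.span {d} := by
  obtain ⟨d, hd, htop⟩ := h
  refine ⟨d, hd, le_antisymm hd.minorIdeal_le ?_⟩
  rw [← Ideal.mul_top (Ideal.span {d}), ← htop, Ideal.span_mul_span', Ideal.span_le]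
  rintro _ ⟨d', hd', b, hb, rfl⟩
  rw [Set.mem_singleton_iff.1 hd']
  exact Ideal.subset_span hb

theorem jEqTop_of_mem_minorIdeal [IsDomain R] {k : ℕ} {F : Matrix (Fin l) (Fin m) R} {d : R}
    (hd : IsGcdMinors k F d) (h0 : d ≠ 0) (hmem : d ∈ minorIdeal k F) : JEqTop k F := by
  refine ⟨d, hd, (Ideal.eq_top_iff_one _).2 ?_⟩
  have hle : minorIdeal k F ≤ Ideal.span {d} * Ideal.span {b : R | d * b ∈ minorsSet k F} := by
    refine Ideal.span_le.2 fun a ha => ?_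
    obtain ⟨b, rfl⟩ := hd.1 a ha
    exact Ideal.mul_mem_mul (Ideal.mem_span_singleton_self d) (Ideal.subset_span ha)
  obtain ⟨y, hy, hdy⟩ := Ideal.mem_span_singleton_mul.1 (hle hmem)
  rwa [mul_right_eq_self₀.1 hdy |>.resolve_right h0] at hy

theorem det_smithForm (d₁ d₂ : R) {p q : ℕ → ℕ} (hp0 : p 0 = 0) (hq0 : q 0 = 0) :
    ∀ k : ℕ, (∀ i < k, p i ≤ p (i + 1) ∧ q i ≤ q (i + 1)) →
      (smithForm d₁ d₂ p q k k).det = d₁ ^ p k * d₂ ^ q k := by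
  intro k hk
  have hdiag : smithForm d₁ d₂ p q k k = Matrix.diagonal fun i : Fin k =>
      d₁ ^ (p ((i : ℕ) + 1) - p (i : ℕ)) * d₂ ^ (q ((i : ℕ) + 1) - q (i : ℕ)) := by
    ext i j
    simp [smithForm, Matrix.diagonal_apply, Fin.ext_iff]
  rw [hdiag, Matrix.det_diagonal]
  clear hdiag
  induction k with
  | zero => simp [hp0, hq0]
  | succ k ih =>
    obtain ⟨h1, h2⟩ := hk k (Nat.lt_succ_self k)
    rw [Fin.prod_univ_castSucc]
    simp only [Fin.val_castSucc, Fin.val_last]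
    rw [ih fun i hi => hk i (hi.trans (Nat.lt_succ_self k)), mul_mul_mul_comm, ← pow_add, ← pow_add,
      Nat.add_sub_cancel' h1, Nat.add_sub_cancel' h2]

theorem mem_minorIdeal_smithForm (d₁ d₂ : R) {p q : ℕ → ℕ} (hp0 : p 0 = 0) (hq0 : q 0 = 0)
    {k : ℕ} (hk : ∀ i < k, p i ≤ p (i + 1) ∧ q i ≤ q (i + 1)) (hkl : k ≤ l) (hkm : k ≤ m) :
    d₁ ^ p k * d₂ ^ q k ∈ minorIdeal k (smithForm d₁ d₂ p q l m) := by
  rw [← det_smithForm d₁ d₂ hp0 hq0 k hk]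
  exact det_submatrix_mem_minorIdeal (smithForm d₁ d₂ p q l m) (Fin.castLE hkl) (Fin.castLE hkm)

end Gcd

/-- Let `F ∈ R^{l×m}` (`l ≤ m`) be of full row rank with `d_l(F)`
associated to `d₁^p d₂^q`, `d₁ = x₁ - f₁(x₂,…,xₙ)`, `d₂ = x₂ - f₂(x₃,…,xₙ)` (`p, q > 0`),
and `d_k(F)` associated to `d₁^{p_k}d₂^{q_k}`.  Then `F` is equivalent to its Smith
normal form `[diag(d₁^{r_1}d₂^{s_1},…,d₁^{r_l}d₂^{s_l})  0]` (`r_k = p_k - p_{k-1}`,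
`s_k = q_k - q_{k-1}`, `p_0 = q_0 = 0`) if and only if `J_k(F) = R` for `k = 1,…,l`. -/
theorem statement18 {K : Type*} [Field K] {n l m : ℕ} (hlm : l ≤ m)
    (v1 v2 : Fin n) (hv1 : (v1 : ℕ) = 0) (hv2 : (v2 : ℕ) = 1)
    (f1 f2 : MvPolynomial (Fin n) K)
    (hf1 : f1 ∈ MvPolynomial.supported K (({v1} : Set (Fin n))ᶜ))
    (hf2 : f2 ∈ MvPolynomial.supported K (({v1, v2} : Set (Fin n))ᶜ))
    (F : Matrix (Fin l) (Fin m) (MvPolynomial (Fin n) K))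
    (hfull : normalRank F = l)
    (p q : ℕ) (hp : 0 < p) (hq : 0 < q)
    (pk qk : ℕ → ℕ) (hpk0 : pk 0 = 0) (hqk0 : qk 0 = 0)
    (hpl : pk l = p) (hql : qk l = q)
    (hd : ∀ k, 1 ≤ k → k ≤ l → ∀ d, IsGcdMinors k F d →
      Associated d ((X v1 - f1) ^ pk k * (X v2 - f2) ^ qk k)) :
    MatEquiv F (Matrix.of fun (i : Fin l) (j : Fin m) =>
      if (i : ℕ) = (j : ℕ) then
        (X v1 - f1) ^ (pk ((i : ℕ) + 1) - pk (i : ℕ)) *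
          (X v2 - f2) ^ (qk ((i : ℕ) + 1) - qk (i : ℕ))
      else 0) ↔
    ∀ k, 1 ≤ k → k ≤ l → JEqTop k F := by
  have hv : v1 ≠ v2 := by
    rintro rfl
    omega
  obtain ⟨ρ₁, ρ₂, hρ⟩ := exists_substPair hv hf1 hf2
  constructor
  · intro hequiv k hk1 hkl
    have hgcd : ∀ k, 1 ≤ k → k ≤ l →
        IsGcdMinors k F ((X v1 - f1) ^ pk k * (X v2 - f2) ^ qk k) := by
      intro k hk1 hkl
      obtain ⟨d, h⟩ := exists_isGcdMinors k F
      exact h.of_associated (hd k hk1 hkl d h)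
    have hmono : ∀ i < k, pk i ≤ pk (i + 1) ∧ qk i ≤ qk (i + 1) := by
      intro i hi
      rcases Nat.eq_zero_or_pos i with rfl | hi0
      · simp [hpk0, hqk0]
      · refine hρ.le_and_le_of_dvd ((hgcd (i + 1) (by omega) (by omega)).2 _ fun a ha => ?_)
        exact Ideal.mem_span_singleton.1 ((hgcd i hi0 (by omega)).minorIdeal_le
          (minorIdeal_succ_le i F (Ideal.subset_span ha)))
    refine jEqTop_of_mem_minorIdeal (hgcd k hk1 hkl)
      (mul_ne_zero (pow_ne_zero _ hρ.ne₁) (pow_ne_zero _ hρ.ne₂)) ?_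
    rw [← minorIdeal_eq_of_matEquiv hequiv]
    exact mem_minorIdeal_smithForm _ _ hpk0 hqk0 hmono hkl (hkl.trans hlm)
  · intro hJ
    refine hρ.matEquiv_smithForm (fun hE => quillen_suslin n K hE) hpk0 hqk0 fun k hk => ?_
    rcases Nat.eq_zero_or_pos k with rfl | hk0
    · rw [minorIdeal_zero, hpk0, hqk0, pow_zero, pow_zero, mul_one, Ideal.span_singleton_one]
    · obtain ⟨d, h, hF⟩ := (hJ k hk0 hk).exists_minorIdeal_eq
      rw [hF]
      exact Ideal.span_singleton_eq_span_singleton.2 (hd k hk0 hk d h)
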